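/- There is no nontrivial compact AE(4)-group: every compact Hausdorff topological group whose underlying space is an AE(4)-compactum consists of a single element. -/

import Mathlib

open Topology

universe u

/-- A topological space `Z` has Lebesgue covering dimension at most `n`:
every finite open cover admits a finite open refinement in which each point
lies in at most `n + 1` members. -/
def CovDimLE (Z : Type u) [TopologicalSpace Z] (n : ℕ) : Prop :=
  ∀ 𝒰 : Finset (Set Z), (∀ U ∈ 𝒰, IsOpen U) → ⋃₀ (𝒰 : Set (Set Z)) = Set.univ →
    ∃ 𝒱 : Finset (Set Z), (∀ V ∈ 𝒱, IsOpen V) ∧ ⋃₀ (𝒱 : Set (Set Z)) = Set.univ ∧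
      (∀ V ∈ 𝒱, ∃ U ∈ 𝒰, V ⊆ U) ∧
      ∀ z : Z, Nat.card {V : Set Z // V ∈ 𝒱 ∧ z ∈ V} ≤ n + 1

/-- `X` is an absolute extensor in dimension `n` (an AE(n)-space): every continuous map
into `X` from a closed subspace of a compact Hausdorff space of covering dimension
at most `n` extends continuously over the whole space. -/
def IsAE (n : ℕ) (X : Type u) [TopologicalSpace X] : Prop :=
  ∀ (Z : Type u) [TopologicalSpace Z], CompactSpace Z → T2Space Z → CovDimLE Z n →
    ∀ Z₀ : Set Z, IsClosed Z₀ → ∀ g₀ : C(Z₀, X),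
      ∃ g : C(Z, X), ∀ z : Z₀, g (z : Z) = g₀ z

/-- `X` is an absolute neighborhood extensor in dimension `4` (an ANE(4)-space):
every continuous map into `X` from a closed subspace `Z₀` of a compact Hausdorff
space of covering dimension at most `4` extends continuously over some open
neighborhood of `Z₀`. -/
def IsANE4 (X : Type u) [TopologicalSpace X] : Prop :=
  ∀ (Z : Type u) [TopologicalSpace Z], CompactSpace Z → T2Space Z → CovDimLE Z 4 →
    ∀ Z₀ : Set Z, IsClosed Z₀ → ∀ g₀ : C(Z₀, X),
      ∃ (U : Set Z) (_ : IsOpen U) (hZ₀U : Z₀ ⊆ U) (g : C(U, X)),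
        ∀ (z : Z) (hz : z ∈ Z₀), g ⟨z, hZ₀U hz⟩ = g₀ ⟨z, hz⟩

/-- The underlying space of `X` is a topological manifold: every point has an open
neighborhood homeomorphic to an open subset of some Euclidean space. -/
def IsTopManifold (X : Type u) [TopologicalSpace X] : Prop :=
  ∀ x : X, ∃ (n : ℕ) (U : Set X) (V : Set (EuclideanSpace ℝ (Fin n))),
    IsOpen U ∧ x ∈ U ∧ IsOpen V ∧ Nonempty (U ≃ₜ V)

/-- The multiplicative equivalence `e` is an isomorphism of topological groups,
i.e. it is continuous with continuous inverse. -/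
def IsTopGroupIso {G H : Type*} [Group G] [Group H] [TopologicalSpace G]
    [TopologicalSpace H] (e : G ≃* H) : Prop :=
  Continuous e ∧ Continuous e.symm

/-- A package consisting of a compact Hausdorff topological group. -/
structure CompactGroupPkg : Type (u + 1) where
  carrier : Type u
  [topology : TopologicalSpace carrier]
  [group : Group carrier]
  [topGroup : IsTopologicalGroup carrier]
  [compact : CompactSpace carrier]
  [t2 : T2Space carrier]

attribute [instance] CompactGroupPkg.topology CompactGroupPkg.group
  CompactGroupPkg.topGroup CompactGroupPkg.compact CompactGroupPkg.t2

/-- `L` is a simple, connected and simply connected compact Lie group: a compact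
Hausdorff topological group whose underlying space is a topological manifold,
which is connected, simply connected, nonabelian, and all of whose closed
normal subgroups other than the whole group are finite. -/
def IsSimpleSCSCLieGroup (L : CompactGroupPkg.{u}) : Prop :=
  IsTopManifold L.carrier ∧ ConnectedSpace L.carrier ∧ SimplyConnectedSpace L.carrier ∧
    (∃ a b : L.carrier, a * b ≠ b * a) ∧
    ∀ N : Subgroup L.carrier, N.Normal → IsClosed (N : Set L.carrier) → N ≠ ⊤ → Finite N

/-- The open star of the lattice point `v` in the Freudenthal triangulation of `ℝᵈ`. -/
def latticeStar {d : ℕ} (v : Fin d → ℤ) : Set (Fin d → ℝ) :=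
  {x | (∀ i, |x i - v i| < 1) ∧ ∀ i j, (x i - v i) - (x j - v j) < 1}

theorem isOpen_latticeStar {d : ℕ} (v : Fin d → ℤ) : IsOpen (latticeStar v) := by
  have : latticeStar v = (⋂ i, {x : Fin d → ℝ | |x i - v i| < 1}) ∩
      ⋂ i, ⋂ j, {x : Fin d → ℝ | (x i - v i) - (x j - v j) < 1} := by
    ext x; simp [latticeStar]
  rw [this]
  refine (isOpen_iInter_of_finite fun i => isOpen_lt (by fun_prop) (by fun_prop)).inter
    (isOpen_iInter_of_finite fun i => isOpen_iInter_of_finite fun j =>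
      isOpen_lt (by fun_prop) (by fun_prop))

theorem mem_latticeStar_floor {d : ℕ} (x : Fin d → ℝ) : x ∈ latticeStar (fun i => ⌊x i⌋) := by
  refine ⟨fun i => ?_, fun i j => ?_⟩
  · rw [abs_lt]; constructor <;> linarith [Int.floor_le (x i), Int.lt_floor_add_one (x i)]
  · linarith [Int.lt_floor_add_one (x i), Int.floor_le (x j)]

theorem exists_eq_floor_add_of_mem_latticeStar {d : ℕ} {v : Fin d → ℤ} {x : Fin d → ℝ}
    (h : x ∈ latticeStar v) : ∃ t : ℝ, 0 ≤ t ∧ t < 1 ∧ ∀ i, v i = ⌊x i + t⌋ := by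
  by_cases h0 : ∀ i, (v i : ℝ) ≤ x i
  · refine ⟨0, le_rfl, one_pos, fun i => ?_⟩
    rw [eq_comm, Int.floor_eq_iff]
    have := abs_lt.1 (h.1 i)
    constructor <;> linarith [h0 i]
  · push Not at h0
    obtain ⟨i₀, hi₀⟩ := h0
    obtain ⟨j, -, hj⟩ := Finset.exists_max_image Finset.univ (fun i => (v i : ℝ) - x i)
      ⟨i₀, by simp⟩
    refine ⟨v j - x j, ?_, ?_, fun i => ?_⟩
    · linarith [hj i₀ (by simp)]
    · linarith [abs_lt.1 (h.1 j)]
    · rw [eq_comm, Int.floor_eq_iff]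
      constructor <;> linarith [hj i (by simp), h.2 i j]

theorem card_latticeStar_le {d : ℕ} (x : Fin d → ℝ) :
    {v : Fin d → ℤ | x ∈ latticeStar v}.Finite ∧
      Nat.card {v : Fin d → ℤ | x ∈ latticeStar v} ≤ d + 1 := by
  have key : ∀ v ∈ {v : Fin d → ℤ | x ∈ latticeStar v},
      ∑ i, (v i - ⌊x i⌋) ∈ Set.Icc (0 : ℤ) d := by
    intro v hv
    obtain ⟨t, ht0, ht1, ht⟩ := exists_eq_floor_add_of_mem_latticeStar hv
    have hb : ∀ i, 0 ≤ v i - ⌊x i⌋ ∧ v i - ⌊x i⌋ ≤ 1 := by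
      intro i
      rw [ht i]
      have h1 : ⌊x i⌋ ≤ ⌊x i + t⌋ := Int.floor_le_floor (by linarith)
      have h2 : ⌊x i + t⌋ ≤ ⌊x i + 1⌋ := Int.floor_le_floor (by linarith)
      rw [Int.floor_add_one] at h2
      constructor <;> linarith
    constructor
    · exact Finset.sum_nonneg fun i _ => (hb i).1
    · calc _ ≤ ∑ i : Fin d, (1 : ℤ) := Finset.sum_le_sum fun i _ => (hb i).2
        _ = d := by simp
  have hinj : Set.InjOn (fun v : Fin d → ℤ => ∑ i, (v i - ⌊x i⌋))
      {v : Fin d → ℤ | x ∈ latticeStar v} := by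
    have mono : ∀ v w : Fin d → ℤ, v ≤ w → ∑ i, (v i - ⌊x i⌋) = ∑ i, (w i - ⌊x i⌋) → v = w := by
      intro v w hvw h
      have := (Finset.sum_eq_sum_iff_of_le (s := Finset.univ)
        (f := fun i => v i - ⌊x i⌋) (g := fun i => w i - ⌊x i⌋)
        (fun i _ => by linarith [hvw i])).1 h
      funext i
      linarith [this i (by simp)]
    intro v hv w hw h
    obtain ⟨t, -, -, ht⟩ := exists_eq_floor_add_of_mem_latticeStar hv
    obtain ⟨s, -, -, hs⟩ := exists_eq_floor_add_of_mem_latticeStar hw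
    rcases le_total t s with hts | hts
    · exact mono v w (fun i => by rw [ht, hs]; exact Int.floor_le_floor (by linarith)) h
    · exact (mono w v (fun i => by rw [ht, hs]; exact Int.floor_le_floor (by linarith)) h.symm).symm
  have hfin := Set.Finite.of_injOn (t := Set.Icc (0 : ℤ) d) key hinj (Set.finite_Icc _ _)
  refine ⟨hfin, ?_⟩
  have := Set.ncard_le_ncard_of_injOn _ key hinj (Set.finite_Icc _ _)
  have h2 : (Set.Icc (0 : ℤ) d).ncard = d + 1 := by
    rw [← Finset.coe_Icc, Set.ncard_coe_finset]; simp
  simpa [h2] using this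

theorem CovDimLE.of_forall_entourage {Z : Type u} [UniformSpace Z] [CompactSpace Z] (d : ℕ)
    (H : ∀ W ∈ uniformity Z, ∃ π : Z → Fin d → ℝ, Continuous π ∧
      ∃ ε > 0, ∀ z z', (∀ i, |π z i - π z' i| < ε) → (z, z') ∈ W) : CovDimLE Z d := by
  classical
  intro 𝒰 hU hcov
  obtain ⟨W, hW, hWU⟩ := lebesgue_number_lemma (K := (Set.univ : Set Z)) isCompact_univ
    (U := fun U : 𝒰 => (U : Set Z)) (fun U => hU U U.2) (by
      rw [← hcov, Set.sUnion_eq_iUnion]; rfl)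
  obtain ⟨π, hπ, ε, hε, hπW⟩ := H W hW
  set p : Z → Fin d → ℝ := fun z i => π z i * (2 / ε) with hp
  have hpc : Continuous p := by fun_prop
  set S : (Fin d → ℤ) → Set Z := fun v => p ⁻¹' latticeStar v
  obtain ⟨B, hB⟩ : ∃ B : ℕ, ∀ z i, |p z i| ≤ B := by
    obtain ⟨B, hB⟩ := (isCompact_univ.image hpc).isBounded.exists_norm_le
    obtain ⟨n, hn⟩ := exists_nat_ge B
    refine ⟨n, fun z i => ?_⟩
    have h1 := hB (p z) ⟨z, trivial, rfl⟩
    have h2 := norm_le_pi_norm (p z) i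
    rw [Real.norm_eq_abs] at h2
    linarith
  have hfin : {v | (S v).Nonempty}.Finite := by
    refine (Set.finite_Icc (fun _ : Fin d => -(B + 1 : ℤ)) (fun _ => (B + 1 : ℤ))).subset ?_
    rintro v ⟨z, hz⟩
    constructor <;> intro i <;> have h1 := abs_lt.1 (hz.1 i) <;> have h2 := abs_le.1 (hB z i) <;>
      simp only
    · have : (-(B + 1) : ℝ) ≤ v i := by linarith
      exact_mod_cast this
    · have : (v i : ℝ) ≤ B + 1 := by linarith
      exact_mod_cast this
  refine ⟨hfin.toFinset.image S, ?_, ?_, ?_, ?_⟩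
  · intro V hV
    obtain ⟨v, -, rfl⟩ := Finset.mem_image.1 hV
    exact (isOpen_latticeStar v).preimage hpc
  · refine Set.eq_univ_of_forall fun z => ⟨S (fun i => ⌊p z i⌋), ?_, mem_latticeStar_floor _⟩
    simp only [Finset.coe_image, Set.Finite.coe_toFinset]
    exact ⟨_, ⟨z, mem_latticeStar_floor _⟩, rfl⟩
  · intro V hV
    obtain ⟨v, hv, rfl⟩ := Finset.mem_image.1 hV
    obtain ⟨z, hz⟩ := hfin.mem_toFinset.1 hv
    obtain ⟨U, hUz⟩ := hWU z trivial
    refine ⟨U, U.2, fun z' hz' => hUz (hπW _ _ fun i => ?_)⟩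
    have h1 := abs_lt.1 (hz.1 i)
    have h2 := abs_lt.1 (hz'.1 i)
    have h3 : |(π z i - π z' i) * (2 / ε)| < 2 := by
      rw [sub_mul, abs_lt]; simp only [hp] at h1 h2; constructor <;> linarith
    rw [abs_mul, abs_of_pos (by positivity : 0 < 2 / ε), mul_div_assoc', div_lt_iff₀ hε] at h3
    linarith
  · intro z
    obtain ⟨hf, hc⟩ := card_latticeStar_le (p z)
    refine le_trans ?_ hc
    have := hf.to_subtype
    refine Nat.card_le_card_of_surjective (fun v : {v | p z ∈ latticeStar v} =>
      (⟨S v, Finset.mem_image.2 ⟨v, hfin.mem_toFinset.2 ⟨z, v.2⟩, rfl⟩, v.2⟩ :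
        {V : Set Z // V ∈ hfin.toFinset.image S ∧ z ∈ V})) ?_
    rintro ⟨V, hV, hz⟩
    obtain ⟨v, hv, rfl⟩ := Finset.mem_image.1 hV
    exact ⟨⟨v, hz⟩, rfl⟩

theorem CovDimLE.mono {Z : Type u} [TopologicalSpace Z] {m n : ℕ} (h : CovDimLE Z m)
    (hmn : m ≤ n) : CovDimLE Z n := fun 𝒰 hU hc =>
  let ⟨𝒱, h1, h2, h3, h4⟩ := h 𝒰 hU hc
  ⟨𝒱, h1, h2, h3, fun z => (h4 z).trans (by omega)⟩

/-- Tower criterion: a compact space which is the limit of a tower of subsets of `ℂᵈ` has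
arbitrarily fine maps to `ℂᵈ`. -/
theorem exists_fine_map_of_tower {Z Y : Type*} [UniformSpace Z] [CompactSpace Z] [MetricSpace Y]
    (π : ℕ → Z → Y) (hπ : ∀ s, Continuous (π s))
    (hmono : ∀ s t, s ≤ t → ∀ z z', π t z = π t z' → π s z = π s z')
    (hinj : ∀ z z', (∀ s, π s z = π s z') → z = z') {W : Set (Z × Z)} (hW : W ∈ uniformity Z) :
    ∃ s, ∃ ε > 0, ∀ z z', dist (π s z) (π s z') < ε → (z, z') ∈ W := by
  have hK : IsCompact (interior W)ᶜ := isOpen_interior.isClosed_compl.isCompact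
  have hcl : ∀ s, IsClosed {p : Z × Z | π s p.1 = π s p.2} := fun s =>
    isClosed_eq ((hπ s).comp continuous_fst) ((hπ s).comp continuous_snd)
  obtain ⟨s, hs⟩ : ∃ s, (interior W)ᶜ ∩ {p : Z × Z | π s p.1 = π s p.2} = ∅ := by
    refine hK.elim_directed_family_closed _ hcl ?_ ?_
    · rw [Set.eq_empty_iff_forall_notMem]
      rintro ⟨z, z'⟩ ⟨h1, h2⟩
      simp only [Set.mem_iInter, Set.mem_ofPred_eq] at h2
      exact h1 ((hinj z z' h2) ▸ mem_uniformity_of_eq (interior_mem_uniformity hW) rfl)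
    · exact directed_of_isDirected_le fun s t hst p hp => hmono s t hst _ _ hp
  refine ⟨s, ?_⟩
  rcases (interior W)ᶜ.eq_empty_or_nonempty with he | hne
  · refine ⟨1, one_pos, fun z z' _ => interior_subset ?_⟩
    rw [Set.compl_empty_iff] at he
    rw [he]; trivial
  · obtain ⟨p, hp, hmin⟩ := hK.exists_isMinOn hne (f := fun p : Z × Z => dist (π s p.1) (π s p.2))
      (Continuous.continuousOn (((hπ s).comp continuous_fst).dist ((hπ s).comp continuous_snd)))
    refine ⟨dist (π s p.1) (π s p.2), dist_pos.2 fun h => ?_, fun z z' hlt => ?_⟩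
    · have : p ∈ (interior W)ᶜ ∩ {p : Z × Z | π s p.1 = π s p.2} := ⟨hp, h⟩
      rw [hs] at this; exact this
    · by_contra hn
      have : (z, z') ∈ (interior W)ᶜ := fun h => hn (interior_subset h)
      exact absurd (hmin this) (not_le.2 hlt)

theorem CovDimLE.of_tower {Z : Type u} [UniformSpace Z] [CompactSpace Z] {d : ℕ}
    (π : ℕ → Z → Fin d → ℂ) (hπ : ∀ s, Continuous (π s))
    (hmono : ∀ s t, s ≤ t → ∀ z z', π t z = π t z' → π s z = π s z')
    (hinj : ∀ z z', (∀ s, π s z = π s z') → z = z') : CovDimLE Z (d * 2) := by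
  refine CovDimLE.of_forall_entourage (d * 2) fun W hW => ?_
  obtain ⟨s, ε, hε, h⟩ := exists_fine_map_of_tower π hπ hmono hinj hW
  refine ⟨fun z k => if (finProdFinEquiv.symm k).2 = 0 then (π s z (finProdFinEquiv.symm k).1).re
    else (π s z (finProdFinEquiv.symm k).1).im, ?_, ε / 2, by positivity, fun z z' hz => h z z' ?_⟩
  · refine continuous_pi fun k => ?_
    split_ifs
    · exact Complex.continuous_re.comp ((continuous_apply _).comp (hπ s))
    · exact Complex.continuous_im.comp ((continuous_apply _).comp (hπ s))
  · rw [dist_pi_lt_iff hε]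
    intro i
    have h0 := hz (finProdFinEquiv (i, 0))
    have h1 := hz (finProdFinEquiv (i, 1))
    simp only [Equiv.symm_apply_apply, if_true, one_ne_zero, if_false, ← Complex.sub_re,
      ← Complex.sub_im] at h0 h1
    rw [dist_eq_norm]
    linarith [Complex.norm_le_abs_re_add_abs_im (π s z i - π s z' i)]

/-- Extension of maps defined on a closed subset of a compact set, for limits of towers. -/
theorem IsAE.exists_extension {G : Type u} [TopologicalSpace G] {n d : ℕ} (h : IsAE n G)
    (hd : d * 2 ≤ n) {A : Type} [UniformSpace A] [T2Space A] {K K₀ : Set A} (hK : IsCompact K)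
    (hK₀ : IsClosed K₀) (hsub : K₀ ⊆ K) (π : ℕ → A → Fin d → ℂ) (hπ : ∀ s, Continuous (π s))
    (hmono : ∀ s t, s ≤ t → ∀ z ∈ K, ∀ z' ∈ K, π t z = π t z' → π s z = π s z')
    (hinj : ∀ z ∈ K, ∀ z' ∈ K, (∀ s, π s z = π s z') → z = z')
    (f : A → G) (hf : ContinuousOn f K₀) :
    ∃ F : A → G, ContinuousOn F K ∧ Set.EqOn F f K₀ := by
  classical
  have := isCompact_iff_compactSpace.1 hK
  have hdim : CovDimLE (ULift.{u} K) n := by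
    refine CovDimLE.mono (CovDimLE.of_tower (fun s (z : ULift.{u} K) => π s z.down)
      (fun s => (hπ s).comp (continuous_subtype_val.comp continuous_uliftDown))
      (fun s t hst z z' => hmono s t hst _ z.down.2 _ z'.down.2)
      (fun z z' hz => ULift.ext _ _ (Subtype.ext (hinj _ z.down.2 _ z'.down.2 hz)))) hd
  set Z₀ : Set (ULift.{u} K) := {z | (z.down : A) ∈ K₀}
  have hZ₀ : IsClosed Z₀ :=
    hK₀.preimage (continuous_subtype_val.comp continuous_uliftDown)
  obtain ⟨g, hg⟩ := h (ULift.{u} K) inferInstance inferInstance hdim Z₀ hZ₀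
    ⟨fun z => f z.1.down, by
      refine hf.comp_continuous (continuous_subtype_val.comp
        (continuous_uliftDown.comp continuous_subtype_val)) fun z => z.2⟩
  refine ⟨fun a => if ha : a ∈ K then g ⟨⟨a, ha⟩⟩ else f a, ?_, fun a ha => ?_⟩
  · rw [continuousOn_iff_continuous_domRestrict]
    have : K.domRestrict (fun a => if ha : a ∈ K then g ⟨⟨a, ha⟩⟩ else f a) =
        fun a => g ⟨a⟩ := by
      ext a; simp [Set.domRestrict]
    rw [this]
    exact g.continuous.comp continuous_uliftUp
  · simp only [hsub ha, dif_pos]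
    exact hg ⟨⟨⟨a, hsub ha⟩⟩, ha⟩

/-- The cone over the dual group of `ℚ`: nonnegative multiples of characters `ℚ → ℂ`. -/
def solCone : Set (ℚ → ℂ) :=
  {w | (∀ q, (‖w q‖ : ℂ) = w 0) ∧ ∀ q q', w q * w q' = w 0 * w (q + q')}

/-- The dual group of the discrete group `ℚ`. -/
def solenoid : Set (ℚ → ℂ) := {u | u ∈ solCone ∧ u 0 = 1}

theorem isClosed_solCone : IsClosed solCone := by
  have : solCone = (⋂ q, {w : ℚ → ℂ | (‖w q‖ : ℂ) = w 0}) ∩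
      ⋂ q, ⋂ q', {w : ℚ → ℂ | w q * w q' = w 0 * w (q + q')} := by
    ext w; simp [solCone]
  rw [this]
  exact (isClosed_iInter fun q => isClosed_eq (by fun_prop) (by fun_prop)).inter
    (isClosed_iInter fun q => isClosed_iInter fun q' => isClosed_eq (by fun_prop) (by fun_prop))

theorem solCone.norm_eq {w : ℚ → ℂ} (hw : w ∈ solCone) (q : ℚ) : ‖w q‖ = ‖w 0‖ := by
  have h := (hw.1 q).trans (hw.1 0).symm
  exact_mod_cast h

theorem solCone.eq_of_eq {w w' : ℚ → ℂ} (hw : w ∈ solCone) (hw' : w' ∈ solCone) {q : ℚ}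
    (h : w q = w' q) (k : ℤ) : w (k * q) = w' (k * q) := by
  have h0 : w 0 = w' 0 := by rw [← hw.1 q, ← hw'.1 q, h]
  by_cases hz : w 0 = 0
  · have e1 := solCone.norm_eq hw (k * q)
    have e2 := solCone.norm_eq hw' (k * q)
    rw [hz, norm_zero, norm_eq_zero] at e1
    rw [← h0, hz, norm_zero, norm_eq_zero] at e2
    rw [e1, e2]
  have hq : w q ≠ 0 := by
    rw [← norm_ne_zero_iff, solCone.norm_eq hw]; simpa using hz
  induction k using Int.induction_on with
  | zero => simpa using h0
  | succ k ih =>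
    have e1 := hw.2 (k * q) q
    have e2 := hw'.2 (k * q) q
    have e3 : ((k + 1 : ℤ) : ℚ) * q = (k : ℚ) * q + q := by push_cast; ring
    rw [e3]
    push_cast at ih
    apply mul_left_cancel₀ hz
    rw [← e1, h0, ← e2, ih, h]
  | pred k ih =>
    have e3 : ((-(k : ℤ) : ℤ) : ℚ) * q = ((-(k : ℤ) - 1 : ℤ) : ℚ) * q + q := by push_cast; ring
    have e1 := hw.2 (((-(k : ℤ) - 1 : ℤ) : ℚ) * q) q
    have e2 := hw'.2 (((-(k : ℤ) - 1 : ℤ) : ℚ) * q) q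
    rw [← e3] at e1 e2
    apply mul_right_cancel₀ hq
    rw [e1, h, e2, h0, ih]

theorem solCone.mul_mem {u w : ℚ → ℂ} (hu : u ∈ solenoid) (hw : w ∈ solCone) :
    u * w ∈ solCone := by
  refine ⟨fun q => ?_, fun q q' => ?_⟩
  · have := hw.1 q
    have h2 := hu.1.1 q
    simp only [Pi.mul_apply, norm_mul, Complex.ofReal_mul, this, h2]
  · have := hw.2 q q'
    have h2 := hu.1.2 q q'
    simp only [Pi.mul_apply]
    linear_combination (u q * u q') * this + (w 0 * w (q + q')) * h2

theorem solenoid.norm_eq {u : ℚ → ℂ} (hu : u ∈ solenoid) (q : ℚ) : ‖u q‖ = 1 := by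
  rw [solCone.norm_eq hu.1, hu.2, norm_one]

theorem solenoid.mul_mem {u w : ℚ → ℂ} (hu : u ∈ solenoid) (hw : w ∈ solenoid) :
    u * w ∈ solenoid := ⟨solCone.mul_mem hu hw.1, by simp [hu.2, hw.2]⟩

theorem solenoid.one_mem : (1 : ℚ → ℂ) ∈ solenoid := ⟨⟨by simp, by simp⟩, by simp⟩

theorem solenoid.star_mul {u : ℚ → ℂ} (hu : u ∈ solenoid) : star u * u = 1 := by
  funext q
  simp only [Pi.mul_apply, Pi.star_apply, Pi.one_apply, Complex.star_def]
  rw [← Complex.normSq_eq_conj_mul_self, Complex.normSq_eq_norm_sq, solenoid.norm_eq hu]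
  simp

theorem solenoid.star_mem {u : ℚ → ℂ} (hu : u ∈ solenoid) : star u ∈ solenoid := by
  refine ⟨⟨fun q => ?_, fun q q' => ?_⟩, by simp [hu.2]⟩
  · simp [solenoid.norm_eq hu, hu.2]
  · have := congrArg star (hu.1.2 q q')
    simpa using this

theorem solenoid.smul_mem {u : ℚ → ℂ} (hu : u ∈ solenoid) {r : ℝ} (hr : 0 ≤ r) :
    r • u ∈ solCone := by
  refine ⟨fun q => ?_, fun q q' => ?_⟩
  · simp [solenoid.norm_eq hu, hu.2, abs_of_nonneg hr]
  · have := hu.1.2 q q'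
    simp only [Pi.smul_apply, Complex.real_smul, hu.2] at this ⊢
    linear_combination (r * r : ℂ) * this

theorem solCone.exists_polar {w : ℚ → ℂ} (hw : w ∈ solCone) :
    ∃ u ∈ solenoid, w = ‖w 0‖ • u := by
  by_cases hz : w 0 = 0
  · refine ⟨1, solenoid.one_mem, ?_⟩
    funext q
    have := solCone.norm_eq hw q
    rw [hz, norm_zero, norm_eq_zero] at this
    simp [this, hz]
  · have hn : ‖w 0‖ ≠ 0 := by simpa using hz
    have hn' : (‖w 0‖ : ℂ) ≠ 0 := by exact_mod_cast hn
    refine ⟨‖w 0‖⁻¹ • w, ⟨⟨fun q => ?_, fun q q' => ?_⟩, ?_⟩, ?_⟩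
    · rw [Pi.smul_apply, norm_smul, Real.norm_of_nonneg (by positivity), Complex.ofReal_mul,
        hw.1 q, Pi.smul_apply, Complex.real_smul]
    · have := hw.2 q q'
      simp only [Pi.smul_apply, Complex.real_smul]
      linear_combination ((‖w 0‖⁻¹ : ℝ) : ℂ) ^ 2 * this
    · simp only [Pi.smul_apply, Complex.real_smul, Complex.ofReal_inv]
      rw [hw.1 0] at hn' ⊢
      exact inv_mul_cancel₀ hn'
    · rw [smul_smul, mul_inv_cancel₀ hn, one_smul]

def solBall (d : ℕ) : Set (Fin d → ℚ → ℂ) := {w | (∀ i, w i ∈ solCone) ∧ ∑ i, ‖w i 0‖ ≤ 1}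

/-- The `d`-fold join of the solenoid. -/
def solSphere (d : ℕ) : Set (Fin d → ℚ → ℂ) := {w | (∀ i, w i ∈ solCone) ∧ ∑ i, ‖w i 0‖ = 1}

theorem solSphere_subset_solBall (d : ℕ) : solSphere d ⊆ solBall d := fun _ h => ⟨h.1, h.2.le⟩

theorem isClosed_solBall (d : ℕ) : IsClosed (solBall d) := by
  have : solBall d = (⋂ i, {w | w i ∈ solCone}) ∩ {w | ∑ i, ‖w i 0‖ ≤ 1} := by
    ext w; simp [solBall]
  rw [this]
  exact (isClosed_iInter fun i => isClosed_solCone.preimage (continuous_apply i)).inter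
    (isClosed_le (by fun_prop) (by fun_prop))

theorem isClosed_solSphere (d : ℕ) : IsClosed (solSphere d) := by
  have : solSphere d = (⋂ i, {w | w i ∈ solCone}) ∩ {w | ∑ i, ‖w i 0‖ = 1} := by
    ext w; simp [solSphere]
  rw [this]
  exact (isClosed_iInter fun i => isClosed_solCone.preimage (continuous_apply i)).inter
    (isClosed_eq (by fun_prop) (by fun_prop))

theorem isCompact_solBall (d : ℕ) : IsCompact (solBall d) := by
  refine (isCompact_univ_pi fun _ : Fin d => isCompact_univ_pi fun _ : ℚ =>
    isCompact_closedBall (0 : ℂ) 1).of_isClosed_subset (isClosed_solBall d) ?_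
  intro w hw i _ q _
  rw [mem_closedBall_zero_iff, solCone.norm_eq (hw.1 i)]
  exact (Finset.single_le_sum (f := fun i => ‖w i 0‖) (fun i _ => norm_nonneg _)
    (Finset.mem_univ i)).trans hw.2

theorem isCompact_solSphere (d : ℕ) : IsCompact (solSphere d) :=
  (isCompact_solBall d).of_isClosed_subset (isClosed_solSphere d) (solSphere_subset_solBall d)

theorem isCompact_solenoid : IsCompact solenoid := by
  refine (isCompact_univ_pi fun _ : ℚ =>
    isCompact_closedBall (0 : ℂ) 1).of_isClosed_subset ?_ ?_
  · exact isClosed_solCone.inter (isClosed_eq (by fun_prop) (by fun_prop))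
  · intro u hu q _
    rw [mem_closedBall_zero_iff, solenoid.norm_eq hu]

theorem solSphere.mul_mem {d : ℕ} {u : ℚ → ℂ} (hu : u ∈ solenoid) {w : Fin d → ℚ → ℂ}
    (hw : w ∈ solSphere d) : (fun i => u * w i) ∈ solSphere d :=
  ⟨fun i => solCone.mul_mem hu (hw.1 i), by simpa [hu.2] using hw.2⟩

theorem solBall.mul_mem {d : ℕ} {u : ℚ → ℂ} (hu : u ∈ solenoid) {w : Fin d → ℚ → ℂ}
    (hw : w ∈ solBall d) : (fun i => u * w i) ∈ solBall d :=
  ⟨fun i => solCone.mul_mem hu (hw.1 i), by simpa [hu.2] using hw.2⟩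

theorem IsAE.exists_extension_solBall {G : Type u} [TopologicalSpace G] {n d : ℕ} (h : IsAE n G)
    (hd : d * 2 ≤ n) (f : (Fin d → ℚ → ℂ) → G) (hf : ContinuousOn f (solSphere d)) :
    ∃ F, ContinuousOn F (solBall d) ∧ Set.EqOn F f (solSphere d) := by
  refine h.exists_extension hd (isCompact_solBall d) (isClosed_solSphere d)
    (solSphere_subset_solBall d) (fun s w i => w i (1 / (s.factorial : ℚ)))
    (fun s => by fun_prop) ?_ ?_ f hf
  · intro s t hst z hz z' hz' hzz
    funext i
    obtain ⟨c, hc⟩ := Nat.factorial_dvd_factorial hst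
    have hs : (s.factorial : ℚ) ≠ 0 := by exact_mod_cast s.factorial_ne_zero
    have ht : (t.factorial : ℚ) ≠ 0 := by exact_mod_cast t.factorial_ne_zero
    have e : 1 / (s.factorial : ℚ) = ((c : ℤ) : ℚ) * (1 / (t.factorial : ℚ)) := by
      have : (t.factorial : ℚ) = s.factorial * c := by exact_mod_cast hc
      field_simp
      rw [this]; push_cast; ring
    rw [e]
    exact solCone.eq_of_eq (hz.1 i) (hz'.1 i) (congrFun hzz i) c
  · intro z hz z' hz' hzz
    funext i q
    obtain ⟨c, hc⟩ := Nat.dvd_factorial q.den_pos le_rfl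
    have hd' : (q.den : ℚ) ≠ 0 := by exact_mod_cast q.den_ne_zero
    have hs : (q.den.factorial : ℚ) ≠ 0 := by exact_mod_cast q.den.factorial_ne_zero
    have e : q = ((q.num * c : ℤ) : ℚ) * (1 / (q.den.factorial : ℚ)) := by
      have h1 : (q.den.factorial : ℚ) = q.den * c := by exact_mod_cast hc
      have h2 := Rat.num_div_den q
      rw [div_eq_iff hd'] at h2
      field_simp
      rw [h1]; push_cast; rw [h2]; ring
    rw [e]
    exact solCone.eq_of_eq (hz.1 i) (hz'.1 i) (congrFun (hzz q.den) i) _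

/-- The parametrization of the `(d+1)`-fold join by the solenoid and the ball. -/
noncomputable def joinMap {d : ℕ} (u : ℚ → ℂ) (w : Fin d → ℚ → ℂ) : Fin (d + 1) → ℚ → ℂ :=
  Fin.snoc (α := fun _ => ℚ → ℂ) (fun i => u * w i) ((1 - ∑ i, ‖w i 0‖) • u)

theorem joinMap_mem {d : ℕ} {u : ℚ → ℂ} (hu : u ∈ solenoid) {w : Fin d → ℚ → ℂ}
    (hw : w ∈ solBall d) : joinMap u w ∈ solSphere (d + 1) := by
  constructor
  · intro i
    refine Fin.lastCases ?_ (fun i => ?_) i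
    · simpa [joinMap] using solenoid.smul_mem hu (sub_nonneg.2 hw.2)
    · simpa [joinMap] using solCone.mul_mem hu (hw.1 i)
  · have : |1 - ∑ i, ‖w i 0‖| = 1 - ∑ i, ‖w i 0‖ := abs_of_nonneg (sub_nonneg.2 hw.2)
    have h2 : ‖(1 : ℂ) - ∑ i, (‖w i 0‖ : ℂ)‖ = 1 - ∑ i, ‖w i 0‖ := by
      rw [← this, ← Real.norm_eq_abs, ← Complex.norm_real]; push_cast; rfl
    simp only [joinMap, Fin.sum_univ_castSucc, Fin.snoc_castSucc, Fin.snoc_last, Pi.mul_apply,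
      hu.2, one_mul, Pi.smul_apply, Complex.real_smul, mul_one]
    push_cast
    rw [h2]; ring

theorem exists_joinMap_eq {d : ℕ} {w : Fin (d + 1) → ℚ → ℂ} (hw : w ∈ solSphere (d + 1)) :
    ∃ u ∈ solenoid, ∃ v ∈ solBall d, joinMap u v = w := by
  obtain ⟨u, hu, huw⟩ := solCone.exists_polar (hw.1 (Fin.last d))
  have hs := hw.2
  rw [Fin.sum_univ_castSucc] at hs
  have hnorm : ∀ i : Fin d, ‖(star u * w i.castSucc) 0‖ = ‖w i.castSucc 0‖ := fun i => by
    simp [hu.2]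
  refine ⟨u, hu, fun i => star u * w i.castSucc, ⟨fun i =>
    solCone.mul_mem (solenoid.star_mem hu) (hw.1 _), ?_⟩, ?_⟩
  · simp only [hnorm]
    linarith [norm_nonneg (w (Fin.last d) 0)]
  · funext i
    refine Fin.lastCases ?_ (fun i => ?_) i
    · simp only [joinMap, Fin.snoc_last, hnorm]
      rw [show w (Fin.last d) = ‖w (Fin.last d) 0‖ • u from huw]
      congr 1
      linarith
    · simp only [joinMap, Fin.snoc_castSucc]
      rw [← mul_assoc, mul_comm u, solenoid.star_mul hu, one_mul]

theorem joinMap_eq_joinMap {d : ℕ} {u u' : ℚ → ℂ} (hu : u ∈ solenoid) (hu' : u' ∈ solenoid)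
    {w w' : Fin d → ℚ → ℂ} (h : joinMap u w = joinMap u' w') :
    (∀ i, u * w i = u' * w' i) ∧ ∑ i, ‖w i 0‖ = ∑ i, ‖w' i 0‖ ∧
      (∑ i, ‖w i 0‖ = 1 ∨ u = u' ∧ w = w') := by
  have h1 : ∀ i, u * w i = u' * w' i := fun i => by
    simpa [joinMap] using congrFun h i.castSucc
  have h2 : ∑ i, ‖w i 0‖ = ∑ i, ‖w' i 0‖ := Finset.sum_congr rfl fun i _ => by
    have := congrArg norm (congrFun (h1 i) 0)
    simpa [hu.2, hu'.2] using this
  refine ⟨h1, h2, ?_⟩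
  by_cases h3 : ∑ i, ‖w i 0‖ = 1
  · exact .inl h3
  · have h4 := congrFun h (Fin.last d)
    simp only [joinMap, Fin.snoc_last, ← h2] at h4
    have huu : u = u' := smul_right_injective _ (sub_ne_zero.2 (Ne.symm h3)) h4
    refine .inr ⟨huu, funext fun i => ?_⟩
    have := congrArg (star u * ·) (h1 i)
    simpa [← huu, ← mul_assoc, solenoid.star_mul hu] using this

/-- Equivariant maps from iterated joins of the solenoid into a group which is an absolute
extensor. -/
theorem IsAE.exists_equivariant {G : Type u} [TopologicalSpace G] [Group G] [IsTopologicalGroup G]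
    {n : ℕ} (h : IsAE n G) {s : (ℚ → ℂ) → G} (hs : ContinuousOn s solenoid)
    (hmul : ∀ u ∈ solenoid, ∀ v ∈ solenoid, s (u * v) = s u * s v) (d : ℕ) (hd : d * 2 ≤ n + 2) :
    ∃ f : (Fin d → ℚ → ℂ) → G, ContinuousOn f (solSphere d) ∧
      ∀ u ∈ solenoid, ∀ w ∈ solSphere d, f (fun i => u * w i) = s u * f w := by
  induction d with
  | zero =>
    refine ⟨fun _ => 1, continuousOn_const, fun u _ w hw => ?_⟩
    have := hw.2
    simp at this
  | succ d ih =>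
    obtain ⟨f, hf, hfe⟩ := ih (by omega)
    obtain ⟨F, hF, hFf⟩ := h.exists_extension_solBall (by omega) f hf
    have := isCompact_iff_compactSpace.1 isCompact_solenoid
    have := isCompact_iff_compactSpace.1 (isCompact_solBall d)
    let p : solenoid × solBall d → solSphere (d + 1) := fun x =>
      ⟨joinMap x.1.1 x.2.1, joinMap_mem x.1.2 x.2.2⟩
    have hp : Continuous p := by
      refine Continuous.subtype_mk (continuous_pi fun i => ?_) _
      have c1 : Continuous fun x : solenoid × solBall d => (x.1 : ℚ → ℂ) :=
        continuous_subtype_val.comp continuous_fst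
      have c2 : ∀ i, Continuous fun x : solenoid × solBall d => (x.2 : Fin d → ℚ → ℂ) i := fun i =>
        (continuous_apply i).comp (continuous_subtype_val.comp continuous_snd)
      have c3 : ∀ i, Continuous fun x : solenoid × solBall d => (x.2 : Fin d → ℚ → ℂ) i 0 :=
        fun i => (continuous_apply 0).comp (c2 i)
      refine Fin.lastCases ?_ (fun i => ?_) i
      · simp only [joinMap, Fin.snoc_last]
        exact (continuous_const.sub (continuous_finsetSum _ fun i _ => (c3 i).norm)).smul c1
      · simp only [joinMap, Fin.snoc_castSucc]
        exact c1.mul (c2 i)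
    have hps : Function.Surjective p := fun w => by
      obtain ⟨u, hu, v, hv, e⟩ := exists_joinMap_eq w.2
      exact ⟨(⟨u, hu⟩, ⟨v, hv⟩), Subtype.ext e⟩
    let k : solenoid × solBall d → G := fun x => s x.1.1 * F x.2.1
    have hk : Continuous k :=
      ((continuousOn_iff_continuous_domRestrict.1 hs).comp continuous_fst).mul
        ((continuousOn_iff_continuous_domRestrict.1 hF).comp continuous_snd)
    have hkp : ∀ u ∈ solenoid, ∀ v ∈ solBall d, ∀ u' ∈ solenoid, ∀ v' ∈ solBall d,
        joinMap u v = joinMap u' v' → s u * F v = s u' * F v' := by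
      intro u hu v hv u' hu' v' hv' e
      obtain ⟨h1, h2, h3 | ⟨rfl, rfl⟩⟩ := joinMap_eq_joinMap hu hu' e
      · have m1 : v ∈ solSphere d := ⟨hv.1, h3⟩
        have m2 : v' ∈ solSphere d := ⟨hv'.1, h2 ▸ h3⟩
        rw [hFf m1, hFf m2, ← hfe u hu v m1, ← hfe u' hu' v' m2]
        exact congrArg f (funext h1)
      · rfl
    let g : solSphere (d + 1) → G := fun w => k (Function.surjInv hps w)
    have hgp : ∀ x, g (p x) = k x := fun x => by
      have e := Function.surjInv_eq hps (p x)
      exact hkp _ (Subtype.prop _) _ (Subtype.prop _) _ (Subtype.prop _) _ (Subtype.prop _)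
        (congrArg Subtype.val e)
    have hg : Continuous g := by
      rw [(hp.isClosedMap.isQuotientMap hp hps).continuous_iff]
      exact hk.congr fun x => (hgp x).symm
    classical
    refine ⟨fun w => if hw : w ∈ solSphere (d + 1) then g ⟨w, hw⟩ else 1, ?_, ?_⟩
    · rw [continuousOn_iff_continuous_domRestrict]
      refine hg.congr fun w => ?_
      simp [Set.domRestrict]
    · intro u hu w hw
      beta_reduce
      rw [dif_pos hw, dif_pos (solSphere.mul_mem hu hw)]
      obtain ⟨⟨⟨v, hv⟩, ⟨w', hw'⟩⟩, e⟩ := hps ⟨w, hw⟩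
      have e1 := congrArg Subtype.val e
      have e2 : (⟨_, solSphere.mul_mem hu hw⟩ : solSphere (d + 1)) =
          p (⟨u * v, solenoid.mul_mem hu hv⟩, ⟨w', hw'⟩) := by
        refine Subtype.ext (funext fun i => ?_)
        simp only [p] at e1 ⊢
        rw [← e1]
        refine Fin.lastCases ?_ (fun i => ?_) i
        · simp [joinMap]
        · simp [joinMap, mul_assoc]
      rw [e2, ← e, hgp, hgp]
      simp only [k]
      rw [hmul u hu v hv, mul_assoc]

section Lattice
variable {N : ℕ} [NeZero N]

noncomputable def phase (α t : Fin 3 → ZMod N) : ℂ := ZMod.stdAddChar (∑ i, α i * t i)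

theorem norm_stdAddChar (a : ZMod N) : ‖(ZMod.stdAddChar a : ℂ)‖ = 1 := by
  rw [ZMod.stdAddChar_apply]; exact Circle.norm_coe _

theorem conj_stdAddChar (a : ZMod N) :
    (starRingEnd ℂ) (ZMod.stdAddChar a : ℂ) = ZMod.stdAddChar (-a) := by
  have h : (ZMod.stdAddChar a : ℂ) * ZMod.stdAddChar (-a) = 1 := by
    rw [← AddChar.map_add_eq_mul]; simp
  have h2 : (starRingEnd ℂ) (ZMod.stdAddChar a : ℂ) * ZMod.stdAddChar a = 1 := by
    rw [mul_comm, Complex.mul_conj, Complex.normSq_eq_norm_sq, norm_stdAddChar]; simp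
  calc _ = (starRingEnd ℂ) (ZMod.stdAddChar a : ℂ) *
        ((ZMod.stdAddChar a : ℂ) * ZMod.stdAddChar (-a)) := by rw [h, mul_one]
    _ = _ := by rw [← mul_assoc, h2, one_mul]

theorem phase_mul_left (α β t : Fin 3 → ZMod N) : phase (α + β) t = phase α t * phase β t := by
  simp [phase, ← AddChar.map_add_eq_mul, add_mul, Finset.sum_add_distrib]

theorem conj_phase (α t : Fin 3 → ZMod N) : (starRingEnd ℂ) (phase α t) = phase (-α) t := by
  simp [phase, conj_stdAddChar, Finset.sum_neg_distrib]

theorem phase_single (i : Fin 3) (β : ZMod N) (t : Fin 3 → ZMod N) :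
    phase (Pi.single i β) t = ZMod.stdAddChar (β * t i) := by
  simp [phase, Pi.single_apply]

theorem phase_add_one (α t : Fin 3 → ZMod N) :
    phase α (t + 1) = ZMod.stdAddChar (∑ i, α i) * phase α t := by
  simp [phase, ← AddChar.map_add_eq_mul, mul_add, Finset.sum_add_distrib, add_comm]

theorem sum_phase (γ : Fin 3 → ZMod N) : ∑ t, phase γ t = if γ = 0 then (N : ℂ) ^ 3 else 0 := by
  classical
  let χ : AddChar (Fin 3 → ZMod N) ℂ :=
    { toFun := phase γ
      map_zero_eq_one' := by simp [phase]
      map_add_eq_mul' := fun a b => by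
        simp [phase, ← AddChar.map_add_eq_mul, mul_add, Finset.sum_add_distrib] }
  have h := AddChar.sum_eq_ite χ
  have e : χ = 0 ↔ γ = 0 := by
    constructor
    · intro h0
      funext i
      have : χ (Pi.single i 1) = 1 := by rw [h0]; rfl
      have h1 : (ZMod.stdAddChar (γ i) : ℂ) = ZMod.stdAddChar (0 : ZMod N) := by
        rw [AddChar.map_zero_eq_one, ← this]
        show _ = phase γ _
        simp [phase, Pi.single_apply]
      exact ZMod.injective_stdAddChar h1
    · rintro rfl
      ext t
      show phase 0 t = 1
      simp [phase]
  calc _ = ∑ t, χ t := rfl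
    _ = _ := by rw [h]; simp [e, Fintype.card_pi, ZMod.card]

theorem sum_norm_sq_phase (c : (Fin 3 → ZMod N) → ℂ) :
    ∑ t, ‖∑ α, c α * phase α t‖ ^ 2 = (N : ℝ) ^ 3 * ∑ α, ‖c α‖ ^ 2 := by
  have key : ((∑ t, ‖∑ α, c α * phase α t‖ ^ 2 : ℝ) : ℂ)
      = ((N ^ 3 * ∑ α, ‖c α‖ ^ 2 : ℝ) : ℂ) := by
    push_cast
    have h1 : ∀ z : ℂ, (‖z‖ : ℂ) ^ 2 = z * (starRingEnd ℂ) z := fun z => by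
      rw [Complex.mul_conj, Complex.normSq_eq_norm_sq]; push_cast; rfl
    simp only [h1, map_sum, map_mul, conj_phase, Finset.sum_mul_sum]
    rw [Finset.sum_comm, Finset.mul_sum]
    refine Finset.sum_congr rfl fun α _ => ?_
    rw [Finset.sum_comm]
    have : ∀ β t, c α * phase α t * ((starRingEnd ℂ) (c β) * phase (-β) t)
        = c α * (starRingEnd ℂ) (c β) * phase (α - β) t := fun β t => by
      rw [sub_eq_add_neg, phase_mul_left]; ring
    simp only [this, ← Finset.mul_sum, sum_phase, sub_eq_zero]
    simp [Finset.sum_ite_eq, mul_comm]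
  exact_mod_cast key

/-- The indicator of the cube of side `L` with lowest corner `a`. -/
noncomputable def cubeInd (L : ℕ) (a r : Fin 3 → ℕ) : ℝ :=
  ∏ i, if a i ≤ r i ∧ r i < a i + L then 1 else 0

theorem cubeInd_sq (L : ℕ) (a r : Fin 3 → ℕ) : cubeInd L a r ^ 2 = cubeInd L a r := by
  rw [cubeInd, ← Finset.prod_pow]
  exact Finset.prod_congr rfl fun i _ => by split_ifs <;> simp

theorem cubeInd_eq_zero_or (L : ℕ) (a r : Fin 3 → ℕ) :
    cubeInd L a r = 0 ∨ (cubeInd L a r = 1 ∧ ∀ i, a i ≤ r i ∧ r i < a i + L) := by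
  by_cases h : ∀ i, a i ≤ r i ∧ r i < a i + L
  · right; exact ⟨Finset.prod_eq_one fun i _ => by simp [h i], h⟩
  · left
    push Not at h
    obtain ⟨i, hi⟩ := h
    refine Finset.prod_eq_zero (Finset.mem_univ i) (if_neg fun h => ?_)
    have := hi h.1; omega

theorem sum_interval_le (N L a : ℕ) :
    ∑ r ∈ Finset.range N, (if a ≤ r ∧ r < a + L then (1 : ℝ) else 0) ≤ L := by
  rw [Finset.sum_boole]
  have : (Finset.range N).filter (fun r => a ≤ r ∧ r < a + L) ⊆ Finset.Ico a (a + L) := by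
    intro r; simp
  have := Finset.card_le_card this
  rw [Nat.card_Ico] at this
  have h : ((Finset.range N).filter (fun r => a ≤ r ∧ r < a + L)).card ≤ L := by omega
  exact_mod_cast h

theorem sum_interval_eq (N L a : ℕ) (h : a + L ≤ N) :
    ∑ r ∈ Finset.range N, (if a ≤ r ∧ r < a + L then (1 : ℝ) else 0) = L := by
  rw [Finset.sum_boole]
  have : (Finset.range N).filter (fun r => a ≤ r ∧ r < a + L) = Finset.Ico a (a + L) := by
    ext r; simp; omega
  rw [this, Nat.card_Ico]; simp

theorem sum_interval_sub_le (N L a a' B : ℕ) (h : a ≤ a') (h' : a' ≤ a + B) :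
    ∑ r ∈ Finset.range N, |(if a ≤ r ∧ r < a + L then (1 : ℝ) else 0)
      - (if a' ≤ r ∧ r < a' + L then (1 : ℝ) else 0)| ≤ 2 * B := by
  calc _ ≤ ∑ r ∈ Finset.range N, ((if a ≤ r ∧ r < a + B then (1 : ℝ) else 0)
      + (if a + L ≤ r ∧ r < a + L + B then (1 : ℝ) else 0)) := by
        refine Finset.sum_le_sum fun r _ => ?_
        split_ifs <;> first | (exfalso; omega) | norm_num
    _ ≤ B + B := by
        rw [Finset.sum_add_distrib]
        exact add_le_add (sum_interval_le _ _ _) (sum_interval_le _ _ _)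
    _ = _ := by ring

theorem sum_interval_sub_le' (N L a a' B : ℕ) (h : a ≤ a' + B) (h' : a' ≤ a + B) :
    ∑ r ∈ Finset.range N, |(if a ≤ r ∧ r < a + L then (1 : ℝ) else 0)
      - (if a' ≤ r ∧ r < a' + L then (1 : ℝ) else 0)| ≤ 2 * B := by
  rcases le_total a a' with hh | hh
  · exact sum_interval_sub_le N L a a' B hh h'
  · simp only [abs_sub_comm (if a ≤ _ ∧ _ < a + L then (1 : ℝ) else 0)]
    exact sum_interval_sub_le N L a' a B hh h

theorem sum_prod_fin (F : Fin 3 → ℕ → ℝ) (N : ℕ) :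
    ∑ ρ : Fin 3 → Fin N, ∏ i, F i (ρ i) = ∏ i, ∑ r ∈ Finset.range N, F i r := by
  simp only [Finset.sum_range]
  rw [Finset.prod_univ_sum, Fintype.piFinset_univ]

theorem sum_cubeInd (N L : ℕ) (a : Fin 3 → ℕ) (h : ∀ i, a i + L ≤ N) :
    ∑ ρ : Fin 3 → Fin N, cubeInd L a (fun i => ρ i) = (L : ℝ) ^ 3 := by
  simp only [cubeInd]
  rw [sum_prod_fin (fun i r => if a i ≤ r ∧ r < a i + L then (1 : ℝ) else 0)]
  simp [sum_interval_eq _ _ _ (h _)]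

theorem sum_cubeInd_le (N L : ℕ) (a : Fin 3 → ℕ) :
    ∑ ρ : Fin 3 → Fin N, cubeInd L a (fun i => ρ i) ≤ (L : ℝ) ^ 3 := by
  simp only [cubeInd]
  rw [sum_prod_fin (fun i r => if a i ≤ r ∧ r < a i + L then (1 : ℝ) else 0)]
  calc _ ≤ ∏ i : Fin 3, (L : ℝ) := Finset.prod_le_prod
        (fun i _ => Finset.sum_nonneg fun r _ => by split_ifs <;> simp)
        (fun i _ => sum_interval_le _ _ _)
    _ = _ := by simp

theorem sum_cubeInd_sub_le (N L B : ℕ) (a a' : Fin 3 → ℕ) (i : Fin 3) (hi : ∀ j ≠ i, a' j = a j)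
    (h : a i ≤ a' i + B) (h' : a' i ≤ a i + B) :
    ∑ ρ : Fin 3 → Fin N, |cubeInd L a (fun i => ρ i) - cubeInd L a' (fun i => ρ i)|
      ≤ 2 * B * (L : ℝ) ^ 2 := by
  let F : Fin 3 → ℕ → ℝ := fun j r => if j = i then
    |(if a i ≤ r ∧ r < a i + L then (1 : ℝ) else 0)
      - (if a' i ≤ r ∧ r < a' i + L then (1 : ℝ) else 0)|
    else (if a j ≤ r ∧ r < a j + L then (1 : ℝ) else 0)
  have e : ∀ ρ : Fin 3 → Fin N, |cubeInd L a (fun i => ρ i) - cubeInd L a' (fun i => ρ i)|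
      = ∏ j, F j (ρ j) := by
    intro ρ
    have h1 : ∏ j ∈ Finset.univ.erase i, F j (ρ j)
        = ∏ j ∈ Finset.univ.erase i, if a j ≤ ρ j ∧ ρ j < a j + L then (1 : ℝ) else 0 :=
      Finset.prod_congr rfl fun j hj => by simp [F, Finset.ne_of_mem_erase hj]
    have h2 : ∏ j ∈ Finset.univ.erase i, (if a' j ≤ ρ j ∧ ρ j < a' j + L then (1 : ℝ) else 0)
        = ∏ j ∈ Finset.univ.erase i, if a j ≤ ρ j ∧ ρ j < a j + L then (1 : ℝ) else 0 :=
      Finset.prod_congr rfl fun j hj => by simp [hi j (Finset.ne_of_mem_erase hj)]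
    rw [cubeInd, cubeInd, ← Finset.mul_prod_erase _ _ (Finset.mem_univ i),
      ← Finset.mul_prod_erase _ _ (Finset.mem_univ i),
      ← Finset.mul_prod_erase _ _ (Finset.mem_univ i), h1, h2, ← sub_mul, abs_mul]
    congr 1
    · simp [F]
    · exact abs_of_nonneg (Finset.prod_nonneg fun j _ => by split_ifs <;> simp)
  simp only [e]
  rw [sum_prod_fin, ← Finset.mul_prod_erase _ _ (Finset.mem_univ i)]
  have h3 : ∏ j ∈ Finset.univ.erase i, ∑ r ∈ Finset.range N, F j r ≤ (L : ℝ) ^ 2 := by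
    calc _ ≤ ∏ j ∈ Finset.univ.erase i, (L : ℝ) := by
          refine Finset.prod_le_prod (fun j hj => ?_) (fun j hj => ?_)
          · exact Finset.sum_nonneg fun r _ => by simp only [F]; split_ifs <;> simp
          · simp only [F, Finset.ne_of_mem_erase hj, if_false]; exact sum_interval_le _ _ _
      _ = _ := by rw [Finset.prod_const, Finset.card_erase_of_mem (Finset.mem_univ i)]; simp
  refine mul_le_mul ?_ h3 (Finset.prod_nonneg fun j _ => Finset.sum_nonneg fun r _ => ?_)
    (by positivity)
  · simp only [F, if_true]; exact sum_interval_sub_le' N L _ _ B h h'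
  · simp only [F]; split_ifs <;> simp

end Lattice

section Spread
variable {N : ℕ} [NeZero N]

abbrev LatticeSpace (N : ℕ) [NeZero N] : Type :=
  EuclideanSpace ℂ ((Fin 3 → Fin N) × (Fin 3 → ZMod N))

def latticeVal (α : Fin 3 → ZMod N) : Fin 3 → ℕ := fun i => (α i).val

noncomputable def spread (L : ℕ) : ((Fin 3 → ZMod N) → ℂ) →ₗ[ℂ] LatticeSpace N where
  toFun x := WithLp.toLp 2 fun p =>
    ∑ α, x α * (cubeInd L (latticeVal α) (fun i => p.1 i) : ℂ) * phase α p.2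
  map_add' x y := by ext p; simp [add_mul, Finset.sum_add_distrib]
  map_smul' c x := by ext p; simp [Finset.mul_sum, mul_assoc]

theorem spread_apply (L : ℕ) (x : (Fin 3 → ZMod N) → ℂ) (p) : spread L x p =
    ∑ α, x α * (cubeInd L (latticeVal α) (fun i => p.1 i) : ℂ) * phase α p.2 := rfl

noncomputable def mulOp (g : (Fin 3 → Fin N) × (Fin 3 → ZMod N) → ℂ) :
    LatticeSpace N →ₗ[ℂ] LatticeSpace N where
  toFun y := WithLp.toLp 2 fun p => g p * y p
  map_add' x y := by ext p; simp [mul_add]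
  map_smul' c x := by ext p; simp [mul_left_comm]

theorem mulOp_apply (g : (Fin 3 → Fin N) × (Fin 3 → ZMod N) → ℂ) (y : LatticeSpace N) (p) :
    mulOp g y p = g p * y p := rfl

theorem norm_mulOp_le {g : (Fin 3 → Fin N) × (Fin 3 → ZMod N) → ℂ} {C : ℝ} (hC : 0 ≤ C)
    (hg : ∀ p, ‖g p‖ ≤ C) (y : LatticeSpace N) : ‖mulOp g y‖ ≤ C * ‖y‖ := by
  refine (sq_le_sq₀ (norm_nonneg _) (by positivity)).1 ?_
  rw [mul_pow, EuclideanSpace.norm_sq_eq, EuclideanSpace.norm_sq_eq, Finset.mul_sum]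
  refine Finset.sum_le_sum fun p _ => ?_
  rw [mulOp_apply, norm_mul, mul_pow]
  gcongr; exact hg p

theorem sum_sum_norm_sq_phase (d : (Fin 3 → Fin N) → (Fin 3 → ZMod N) → ℂ) :
    ∑ p : (Fin 3 → Fin N) × (Fin 3 → ZMod N), ‖∑ α, d p.1 α * phase α p.2‖ ^ 2
      = (N : ℝ) ^ 3 * ∑ α, ∑ ρ, ‖d ρ α‖ ^ 2 := by
  rw [Fintype.sum_prod_type]
  simp only [sum_norm_sq_phase (d _)]
  rw [← Finset.mul_sum]
  congr 1
  exact Finset.sum_comm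

theorem norm_spread_sq {L : ℕ} {x : (Fin 3 → ZMod N) → ℂ}
    (hx : ∀ α, x α ≠ 0 → ∀ i, (α i).val + L ≤ N) :
    ‖spread L x‖ ^ 2 = (N : ℝ) ^ 3 * ((L : ℝ) ^ 3 * ∑ α, ‖x α‖ ^ 2) := by
  rw [EuclideanSpace.norm_sq_eq]
  simp only [spread_apply]
  rw [sum_sum_norm_sq_phase (fun ρ α => x α * (cubeInd L (latticeVal α) (fun i => ρ i) : ℂ)),
    Finset.mul_sum (a := (L : ℝ) ^ 3)]
  congr 1
  refine Finset.sum_congr rfl fun α _ => ?_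
  have : ∀ ρ : Fin 3 → Fin N, ‖x α * (cubeInd L (latticeVal α) (fun i => ρ i) : ℂ)‖ ^ 2
      = cubeInd L (latticeVal α) (fun i => ρ i) * ‖x α‖ ^ 2 := fun ρ => by
    rw [norm_mul, mul_pow, Complex.norm_real, Real.norm_eq_abs, sq_abs, cubeInd_sq, mul_comm]
  simp only [this, ← Finset.sum_mul]
  by_cases h0 : x α = 0
  · simp [h0]
  · rw [sum_cubeInd N L (latticeVal α) (hx α h0)]

noncomputable def ratio (a : Fin 3 → ℕ) (i : Fin 3) : ℝ := (a i + 1) / ∑ j, ((a j : ℝ) + 1)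

theorem ratio_nonneg (a : Fin 3 → ℕ) (i : Fin 3) : 0 ≤ ratio a i := by
  unfold ratio; positivity

theorem sum_ratio (a : Fin 3 → ℕ) : ∑ i, ratio a i = 1 := by
  simp only [ratio]
  rw [← Finset.sum_div]
  have : 0 < ∑ j, ((a j : ℝ) + 1) := Finset.sum_pos (fun i _ => by positivity) ⟨0, by simp⟩
  exact div_self this.ne'

theorem ratio_le_one (a : Fin 3 → ℕ) (i : Fin 3) : ratio a i ≤ 1 := by
  rw [← sum_ratio a]
  exact Finset.single_le_sum (fun j _ => ratio_nonneg a j) (Finset.mem_univ i)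

theorem abs_ratio_sub_le {L K : ℕ} (hK : 0 < K) {a r : Fin 3 → ℕ} (ha : K ≤ ∑ j, a j)
    (h : ∀ j, a j ≤ r j ∧ r j < a j + L) (i : Fin 3) :
    |ratio r i - ratio a i| ≤ 3 * L / K := by
  have hS : (K : ℝ) ≤ ∑ j, ((a j : ℝ) + 1) := by
    rw [Finset.sum_add_distrib]
    have : (K : ℝ) ≤ ∑ j, (a j : ℝ) := by exact_mod_cast ha
    have h2 : (0 : ℝ) ≤ ∑ j : Fin 3, (1 : ℝ) := by simp
    linarith
  have hle : ∀ j, (a j : ℝ) ≤ r j := fun j => by exact_mod_cast (h j).1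
  have hlt : ∀ j, (r j : ℝ) ≤ a j + L := fun j => by exact_mod_cast (h j).2.le
  have hSS : ∑ j, ((a j : ℝ) + 1) ≤ ∑ j, ((r j : ℝ) + 1) :=
    Finset.sum_le_sum fun j _ => by linarith [hle j]
  have hSL : ∑ j, ((r j : ℝ) + 1) ≤ ∑ j, ((a j : ℝ) + 1) + 3 * L := by
    calc _ ≤ ∑ j, (((a j : ℝ) + 1) + L) := Finset.sum_le_sum fun j _ => by linarith [hlt j]
      _ = _ := by rw [Finset.sum_add_distrib]; simp
  have hA : (a i : ℝ) + 1 ≤ ∑ j, ((a j : ℝ) + 1) :=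
    Finset.single_le_sum (f := fun j => (a j : ℝ) + 1) (fun j _ => by positivity)
      (Finset.mem_univ i)
  have hK' : (0 : ℝ) < K := by exact_mod_cast hK
  unfold ratio
  set S := ∑ j, ((a j : ℝ) + 1)
  set S' := ∑ j, ((r j : ℝ) + 1)
  have hSpos : 0 < S := by linarith
  have hS'pos : 0 < S' := by linarith
  have hai : (0 : ℝ) ≤ a i := by positivity
  have hL : (0 : ℝ) ≤ L := by positivity
  have e : ((r i : ℝ) + 1) / S' - (a i + 1) / S
      = (((r i : ℝ) - a i) - (S' - S) * ((a i + 1) / S)) / S' := by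
    field_simp; ring
  have hq : ((a i : ℝ) + 1) / S ≤ 1 := (div_le_one hSpos).2 hA
  have hq0 : 0 ≤ ((a i : ℝ) + 1) / S := by positivity
  rw [e, abs_div, abs_of_pos hS'pos]
  refine div_le_div₀ (by positivity) ?_ hK' (hS.trans hSS)
  have h1 : 0 ≤ (S' - S) * ((a i + 1) / S) := mul_nonneg (by linarith) hq0
  have h2 : (S' - S) * ((a i + 1) / S) ≤ 3 * L := by
    calc _ ≤ (S' - S) * 1 := mul_le_mul_of_nonneg_left hq (by linarith)
      _ ≤ _ := by linarith
  rw [abs_le]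
  constructor <;> linarith [hle i, hlt i]

theorem ratio_le_of_small {L K B : ℕ} (hK : 0 < K) {a r : Fin 3 → ℕ} (ha : K ≤ ∑ j, a j)
    (h : ∀ j, a j ≤ r j ∧ r j < a j + L) {i : Fin 3} (hi : a i < B) :
    ratio r i ≤ (B + L) / K := by
  have hS : (K : ℝ) ≤ ∑ j, ((r j : ℝ) + 1) := by
    rw [Finset.sum_add_distrib]
    have : (K : ℝ) ≤ ∑ j, (r j : ℝ) := by
      exact_mod_cast ha.trans (Finset.sum_le_sum fun j _ => (h j).1)
    have h2 : (0 : ℝ) ≤ ∑ j : Fin 3, (1 : ℝ) := by simp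
    linarith
  have hK' : (0 : ℝ) < K := by exact_mod_cast hK
  refine div_le_div₀ (by positivity) ?_ hK' hS
  have := (h i).2
  exact_mod_cast (show r i + 1 ≤ B + L by omega)

theorem val_add_intCast {v : ZMod N} {β : ℤ} (h0 : 0 ≤ (v.val : ℤ) + β)
    (h1 : (v.val : ℤ) + β < N) : ((v + β : ZMod N).val : ℤ) = v.val + β := by
  have : v + (β : ZMod N) = (((v.val : ℤ) + β : ℤ) : ZMod N) := by push_cast; simp
  rw [this, ZMod.val_intCast, Int.emod_eq_of_lt h0 h1]

theorem exists_spread_approx {L K B : ℕ} (hK : 0 < K) (i : Fin 3) {β : ℤ} (hβ : |β| ≤ B)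
    {x : (Fin 3 → ZMod N) → ℂ}
    (hx : ∀ α, x α ≠ 0 → K ≤ ∑ j, (α j).val ∧ ∀ j, (α j).val + L + B ≤ N) (hB : 0 < L) :
    ∃ z : (Fin 3 → ZMod N) → ℂ,
      (∀ γ, z γ ≠ 0 → ∃ α, x α ≠ 0 ∧ |(∑ j, ((γ j).val : ℤ)) - ∑ j, ((α j).val : ℤ)| ≤ B) ∧
      ‖mulOp (fun p => (ratio (fun j => p.1 j) i : ℂ) * ZMod.stdAddChar ((β : ZMod N) * p.2 i))
        (spread L x)
        - spread L z‖ ^ 2 ≤ (N : ℝ) ^ 3 *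
          ((2 * ((3 * L + B : ℝ) / K) ^ 2 * L ^ 3 + 4 * B * L ^ 2) * ∑ α, ‖x α‖ ^ 2) := by
  set σ : (Fin 3 → ZMod N) ≃ (Fin 3 → ZMod N) := Equiv.addRight (Pi.single i (β : ZMod N)) with hσ
  let c : (Fin 3 → ZMod N) → ℝ := fun α =>
    if 0 ≤ ((α i).val : ℤ) + β then ratio (latticeVal α) i else 0
  let z : (Fin 3 → ZMod N) → ℂ := fun γ => c (σ.symm γ) * x (σ.symm γ)
  have hzσ : ∀ α, z (σ α) = c α * x α := fun α => by simp [z]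
  have hβ' := abs_le.1 hβ
  have hσi : ∀ α, (σ α) i = α i + β := fun α => by simp [hσ]
  have hσj : ∀ α, ∀ j ≠ i, (σ α) j = α j := fun α j hj => by simp [hσ, hj]
  have hval : ∀ α, x α ≠ 0 → 0 ≤ ((α i).val : ℤ) + β →
      (((σ α) i).val : ℤ) = (α i).val + β := by
    intro α hα h0
    rw [hσi]
    refine val_add_intCast h0 ?_
    have := (hx α hα).2 i; omega
  refine ⟨z, fun γ hγ => ?_, ?_⟩
  · obtain ⟨α, rfl⟩ := σ.surjective γ
    rw [hzσ] at hγ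
    have hα := right_ne_zero_of_mul hγ
    have h0 : 0 ≤ ((α i).val : ℤ) + β := by
      by_contra h
      have hc : c α = 0 := if_neg h
      exact hγ (by rw [hc]; simp)
    refine ⟨α, hα, ?_⟩
    rw [← Finset.sum_sub_distrib, Finset.sum_eq_single i]
    · rw [hval α hα h0]; simpa using hβ
    · intro j _ hj; rw [hσj α j hj]; simp
    · simp
  rw [EuclideanSpace.norm_sq_eq]
  let d : (Fin 3 → Fin N) → (Fin 3 → ZMod N) → ℂ := fun ρ α =>
    x α * ((ratio (fun j => ρ j) i * cubeInd L (latticeVal α) (fun j => ρ j)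
      - c α * cubeInd L (latticeVal (σ α)) (fun j => ρ j) : ℝ) : ℂ)
  have e : ∀ p : (Fin 3 → Fin N) × (Fin 3 → ZMod N),
      (mulOp (fun p => (ratio (fun j => p.1 j) i : ℂ) * ZMod.stdAddChar ((β : ZMod N) * p.2 i))
        (spread L x)
        - spread L z) p = ∑ γ, d p.1 (σ.symm γ) * phase γ p.2 := by
    intro p
    rw [PiLp.sub_apply, mulOp_apply, spread_apply, spread_apply,
      ← σ.sum_comp (fun γ => d p.1 (σ.symm γ) * phase γ p.2),
      ← σ.sum_comp (fun γ => z γ * (cubeInd L (latticeVal γ) (fun i => p.1 i) : ℂ) * phase γ p.2),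
      Finset.mul_sum, ← Finset.sum_sub_distrib]
    refine Finset.sum_congr rfl fun α _ => ?_
    rw [hzσ, Equiv.symm_apply_apply]
    have : phase (σ α) p.2 = phase α p.2 * ZMod.stdAddChar ((β : ZMod N) * p.2 i) := by
      rw [hσ, Equiv.coe_addRight, phase_mul_left, phase_single]
    rw [this]; simp only [d]; push_cast; ring
  simp only [e]
  rw [sum_sum_norm_sq_phase (fun ρ γ => d ρ (σ.symm γ)), ← σ.sum_comp, Finset.mul_sum (a := _ + _)]
  simp only [Equiv.symm_apply_apply]
  refine mul_le_mul_of_nonneg_left (Finset.sum_le_sum fun α _ => ?_) (by positivity)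
  by_cases hα : x α = 0
  · simp [d, hα]
  have hxK : K ≤ ∑ j, latticeVal α j := (hx α hα).1
  have hxN := (hx α hα).2
  have hK' : (0 : ℝ) < K := by exact_mod_cast hK
  have hd : ∀ ρ : Fin 3 → Fin N, ‖d ρ α‖ ^ 2 =
      (ratio (fun j => ρ j) i * cubeInd L (latticeVal α) (fun j => ρ j)
      - c α * cubeInd L (latticeVal (σ α)) (fun j => ρ j)) ^ 2 * ‖x α‖ ^ 2 := fun ρ => by
    simp only [d]
    rw [norm_mul, mul_pow, Complex.norm_real, Real.norm_eq_abs, sq_abs, mul_comm]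
  simp only [hd, ← Finset.sum_mul]
  refine mul_le_mul_of_nonneg_right ?_ (by positivity)
  set δ : ℝ := (3 * L + B : ℝ) / K with hδ
  have hδ0 : 0 ≤ δ := by positivity
  by_cases h0 : 0 ≤ ((α i).val : ℤ) + β
  · have hc : c α = ratio (latticeVal α) i := if_pos h0
    have hv := hval α hα h0
    calc _ ≤ ∑ ρ : Fin 3 → Fin N, (2 * δ ^ 2 * cubeInd L (latticeVal α) (fun j => ρ j)
          + 2 * |cubeInd L (latticeVal α) (fun j => ρ j)
            - cubeInd L (latticeVal (σ α)) (fun j => ρ j)|) := by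
          refine Finset.sum_le_sum fun ρ _ => ?_
          rw [hc]
          set X := cubeInd L (latticeVal α) (fun j => ρ j) with hX
          set Y := cubeInd L (latticeVal (σ α)) (fun j => ρ j) with hY
          have h1 : ((ratio (fun j => ρ j) i - ratio (latticeVal α) i) * X) ^ 2 ≤ δ ^ 2 * X := by
            rcases cubeInd_eq_zero_or L (latticeVal α) (fun j => ρ j) with h | ⟨h, hh⟩
            · rw [hX, h]; simp
            · rw [hX, h, mul_one, mul_one]
              refine sq_le_sq' ?_ ?_ <;>
              have := abs_le.1 (abs_ratio_sub_le hK hxK hh i) <;>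
              have h3 : (3 * L : ℝ) / K ≤ δ := by
                  rw [hδ]; gcongr; simp
              · linarith
              · linarith
          have h2 : (ratio (latticeVal α) i * (X - Y)) ^ 2 ≤ |X - Y| := by
            have hr : ratio (latticeVal α) i ^ 2 ≤ 1 :=
              pow_le_one₀ (ratio_nonneg _ _) (ratio_le_one _ _)
            have hXY : (X - Y) ^ 2 ≤ |X - Y| := by
              rcases cubeInd_eq_zero_or L (latticeVal α) (fun j => ρ j) with h | ⟨h, -⟩ <;>
              rcases cubeInd_eq_zero_or L (latticeVal (σ α)) (fun j => ρ j) with h' | ⟨h', -⟩ <;>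
              rw [hX, hY, h, h'] <;> norm_num
            rw [mul_pow]
            calc _ ≤ 1 * (X - Y) ^ 2 := mul_le_mul_of_nonneg_right hr (by positivity)
              _ ≤ _ := by linarith
          nlinarith [sq_nonneg ((ratio (fun j => ρ j) i - ratio (latticeVal α) i) * X
            - ratio (latticeVal α) i * (X - Y))]
      _ ≤ 2 * δ ^ 2 * L ^ 3 + 2 * (2 * B * (L : ℝ) ^ 2) := by
          rw [Finset.sum_add_distrib, ← Finset.mul_sum, ← Finset.mul_sum]
          gcongr
          · exact sum_cubeInd_le _ _ _
          · refine sum_cubeInd_sub_le _ _ B _ _ i (fun j hj => ?_) ?_ ?_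
            · simp only [latticeVal, hσj α j hj]
            · simp only [latticeVal]; omega
            · simp only [latticeVal]; omega
      _ = _ := by ring
  · have hc : c α = 0 := if_neg h0
    calc _ ≤ ∑ ρ : Fin 3 → Fin N, δ ^ 2 * cubeInd L (latticeVal α) (fun j => ρ j) := by
          refine Finset.sum_le_sum fun ρ _ => ?_
          rw [hc, zero_mul, sub_zero]
          rcases cubeInd_eq_zero_or L (latticeVal α) (fun j => ρ j) with h | ⟨h, hh⟩
          · rw [h]; simp
          · rw [h, mul_one, mul_one]
            refine pow_le_pow_left₀ (ratio_nonneg _ _) ?_ 2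
            refine (ratio_le_of_small hK hxK hh (B := B) (i := i) ?_).trans ?_
            · show (α i).val < B
              omega
            · have : (0 : ℝ) ≤ L := by positivity
              exact div_le_div_of_nonneg_right (by linarith) hK'.le
      _ ≤ δ ^ 2 * L ^ 3 := by
          rw [← Finset.mul_sum]
          exact mul_le_mul_of_nonneg_left (sum_cubeInd_le _ _ _) (by positivity)
      _ ≤ _ := by
          have : 0 ≤ δ ^ 2 * (L : ℝ) ^ 3 := by positivity
          have : 0 ≤ 4 * (B : ℝ) * L ^ 2 := by positivity
          linarith

end Spread

section Sampling

def stepSize (s : ℕ) : ℕ := (s + 1).factorial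
def cubeSide (s : ℕ) : ℕ := (s + 1) * stepSize s
def midLevel (s : ℕ) : ℕ := (s + 1) * cubeSide s
def modulus (s : ℕ) : ℕ := 4 * midLevel s

theorem stepSize_pos (s : ℕ) : 0 < stepSize s := Nat.factorial_pos _
theorem cubeSide_pos (s : ℕ) : 0 < cubeSide s := Nat.mul_pos s.succ_pos (stepSize_pos s)
theorem midLevel_pos (s : ℕ) : 0 < midLevel s := Nat.mul_pos s.succ_pos (cubeSide_pos s)

instance (s : ℕ) : NeZero (modulus s) := ⟨by have := midLevel_pos s; unfold modulus; omega⟩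

theorem mul_stepSize_le {D s : ℕ} (h : D ≤ s + 1) : D * stepSize s ≤ cubeSide s :=
  Nat.mul_le_mul_right _ h

theorem cubeSide_le (s : ℕ) : cubeSide s ≤ midLevel s := Nat.le_mul_of_pos_left _ s.succ_pos

noncomputable def expChar (c : ℝ) : ℚ → ℂ := fun q =>
  Complex.exp (2 * Real.pi * Complex.I * (q * c))

theorem norm_expChar (c : ℝ) (q : ℚ) : ‖expChar c q‖ = 1 := by
  have : (2 * Real.pi * Complex.I * (q * c) : ℂ) =
      ((2 * Real.pi * (q * c) : ℝ) : ℂ) * Complex.I := by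
    push_cast; ring
  rw [expChar, this, Complex.norm_exp_ofReal_mul_I]

theorem expChar_mem (c : ℝ) : expChar c ∈ solenoid := by
  have h0 : expChar c 0 = 1 := by simp [expChar]
  refine ⟨⟨fun q => by rw [norm_expChar, h0]; simp, fun q q' => ?_⟩, h0⟩
  rw [h0, one_mul]
  simp only [expChar, ← Complex.exp_add]
  congr 1; push_cast; ring

abbrev SampleIndex (s : ℕ) : Type := (Fin 3 → Fin (modulus s)) × (Fin 3 → ZMod (modulus s))

noncomputable def sampleAngle (s : ℕ) (t : Fin 3 → ZMod (modulus s)) (i : Fin 3) : ℝ :=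
  stepSize s * ((t 0).val + (t i - t 0).val) / modulus s

noncomputable def samplePoint (s : ℕ) (p : SampleIndex s) : solSphere 3 :=
  ⟨fun i => ratio (fun j => p.1 j) i • expChar (sampleAngle s p.2 i),
    fun i => solenoid.smul_mem (expChar_mem _) (ratio_nonneg _ _), by
      simp only [Pi.smul_apply, norm_smul, norm_expChar, mul_one, Real.norm_eq_abs,
        abs_of_nonneg (ratio_nonneg _ _), sum_ratio]⟩

theorem samplePoint_apply (s : ℕ) (p : SampleIndex s) (i : Fin 3) (q : ℚ) :
    (samplePoint s p).1 i q
      = (ratio (fun j => p.1 j) i : ℂ) * expChar (sampleAngle s p.2 i) q := by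
  simp [samplePoint]

theorem expChar_sampleAngle {s : ℕ} {q : ℚ} {β : ℤ} (h : q * stepSize s = β)
    (t : Fin 3 → ZMod (modulus s)) (i : Fin 3) :
    expChar (sampleAngle s t i) q = ZMod.stdAddChar ((β : ZMod (modulus s)) * t i) := by
  have e : (β : ZMod (modulus s)) * t i
      = ((β * ((t 0).val + (t i - t 0).val) : ℤ) : ZMod (modulus s)) := by
    push_cast; simp
  have h' : (q : ℂ) * stepSize s = β := by exact_mod_cast congrArg (Rat.cast : ℚ → ℂ) h
  rw [e, ZMod.stdAddChar_coe, expChar, sampleAngle]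
  congr 1
  push_cast
  rw [← h']; ring

def SuppNear (s D : ℕ) (x : (Fin 3 → ZMod (modulus s)) → ℂ) : Prop :=
  ∀ α, x α ≠ 0 → |(∑ j, ((α j).val : ℤ)) - midLevel s| ≤ D * stepSize s

theorem SuppNear.val_le {s D : ℕ} {x : (Fin 3 → ZMod (modulus s)) → ℂ} (hx : SuppNear s D x)
    (hD : D ≤ s + 1) (α) (hα : x α ≠ 0) (i : Fin 3) :
    (α i).val + 2 * cubeSide s ≤ modulus s := by
  have h1 := (abs_le.1 (hx α hα)).2
  have h2 : (α i).val ≤ ∑ j, (α j).val :=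
    Finset.single_le_sum (f := fun j => (α j).val) (fun j _ => Nat.zero_le _) (Finset.mem_univ i)
  have h3 := mul_stepSize_le hD
  have h4 := cubeSide_le s
  have hN : modulus s = 4 * midLevel s := rfl
  have h5 : ((∑ j, (α j).val : ℕ) : ℤ) - midLevel s ≤ (D * stepSize s : ℕ) := by
    push_cast; exact h1
  omega

theorem SuppNear.norm_spread_sq {s D : ℕ} {x : (Fin 3 → ZMod (modulus s)) → ℂ}
    (hx : SuppNear s D x) (hD : D ≤ s + 1) : ‖spread (cubeSide s) x‖ ^ 2
      = (modulus s : ℝ) ^ 3 * ((cubeSide s : ℝ) ^ 3 * ∑ α, ‖x α‖ ^ 2) :=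
  _root_.norm_spread_sq fun α hα i => by have := hx.val_le hD α hα i; omega

/-- Multiplication by `h` almost preserves the span of lattice points near the middle level. -/
def AlmostPreserves (h : C(solSphere 3, ℂ)) : Prop :=
  ∀ ε > (0 : ℝ), ∀ D : ℕ, ∃ C : ℕ, ∀ᶠ s in Filter.atTop, ∀ x, SuppNear s D x → ∃ z, SuppNear s C z ∧
    ‖mulOp (fun p => h (samplePoint s p)) (spread (cubeSide s) x) - spread (cubeSide s) z‖
      ≤ ε * ‖spread (cubeSide s) x‖

instance : CompactSpace (solSphere 3) := isCompact_iff_compactSpace.1 (isCompact_solSphere 3)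

theorem norm_mulOp_sample_le (h : C(solSphere 3, ℂ)) (s : ℕ) (y : LatticeSpace (modulus s)) :
    ‖mulOp (fun p => h (samplePoint s p)) y‖ ≤ ‖h‖ * ‖y‖ :=
  norm_mulOp_le (norm_nonneg _) (fun _ => h.norm_coe_le_norm _) y

theorem SuppNear.mono {s D D' : ℕ} (hD : D ≤ D') {x} (hx : SuppNear s D x) : SuppNear s D' x :=
  fun α hα => (hx α hα).trans (by gcongr)

theorem SuppNear.add {s D D' : ℕ} {x y} (hx : SuppNear s D x) (hy : SuppNear s D' y) :
    SuppNear s (max D D') (x + y) := fun α hα => by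
  by_cases h : x α = 0
  · refine hy.mono (le_max_right _ _) α fun h' => hα (by simp [h, h'])
  · exact hx.mono (le_max_left _ _) α h

theorem AlmostPreserves.add {h h' : C(solSphere 3, ℂ)} (H : AlmostPreserves h)
    (H' : AlmostPreserves h') : AlmostPreserves (h + h') := by
  intro ε hε D
  obtain ⟨C, hC⟩ := H (ε / 2) (by positivity) D
  obtain ⟨C', hC'⟩ := H' (ε / 2) (by positivity) D
  refine ⟨max C C', ?_⟩
  filter_upwards [hC, hC'] with s h1 h2 x hx
  obtain ⟨z, hz, e⟩ := h1 x hx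
  obtain ⟨z', hz', e'⟩ := h2 x hx
  refine ⟨z + z', hz.add hz', ?_⟩
  have : mulOp (fun p => (h + h') (samplePoint s p)) (spread (cubeSide s) x)
      - spread (cubeSide s) (z + z')
      = (mulOp (fun p => h (samplePoint s p)) (spread (cubeSide s) x) - spread (cubeSide s) z)
      + (mulOp (fun p => h' (samplePoint s p)) (spread (cubeSide s) x)
        - spread (cubeSide s) z') := by
    rw [map_add]; ext p; simp [mulOp_apply]; ring
  rw [this]
  refine (norm_add_le _ _).trans ?_
  linarith

theorem AlmostPreserves.const (c : ℂ) : AlmostPreserves (ContinuousMap.const _ c) := by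
  intro ε hε D
  refine ⟨D, Filter.Eventually.of_forall fun s x hx => ⟨c • x, fun α hα => hx α ?_, ?_⟩⟩
  · exact fun h => hα (by simp [h])
  · have : mulOp (fun p => (ContinuousMap.const _ c : C(solSphere 3, ℂ)) (samplePoint s p))
        (spread (cubeSide s) x) - spread (cubeSide s) (c • x) = 0 := by
      rw [map_smul]; ext p; simp [mulOp_apply]
    rw [this, norm_zero]; positivity

theorem AlmostPreserves.mul {h h' : C(solSphere 3, ℂ)} (H : AlmostPreserves h)
    (H' : AlmostPreserves h') : AlmostPreserves (h * h') := by
  intro ε hε D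
  set δ := ε / (‖h‖ + (‖h'‖ + 1) + 1) with hδ
  have hδ0 : 0 < δ := by positivity
  have hδε : δ * (‖h‖ + (‖h'‖ + 1) + 1) = ε := div_mul_cancel₀ _ (by positivity)
  set δ' := min δ 1
  have hδ'0 : 0 < δ' := lt_min hδ0 one_pos
  obtain ⟨C', hC'⟩ := H' δ' hδ'0 D
  obtain ⟨C, hC⟩ := H δ hδ0 C'
  refine ⟨C, ?_⟩
  filter_upwards [hC, hC'] with s h1 h2 x hx
  obtain ⟨z', hz', e'⟩ := h2 x hx
  obtain ⟨z, hz, e⟩ := h1 z' hz'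
  refine ⟨z, hz, ?_⟩
  set X := spread (cubeSide s) x
  set Z' := spread (cubeSide s) z'
  set Z := spread (cubeSide s) z
  have : mulOp (fun p => (h * h') (samplePoint s p)) X - Z
      = mulOp (fun p => h (samplePoint s p)) (mulOp (fun p => h' (samplePoint s p)) X - Z')
      + (mulOp (fun p => h (samplePoint s p)) Z' - Z) := by
    rw [map_sub]; ext p; simp [mulOp_apply]; ring
  rw [this]
  have hX := norm_nonneg X
  have b1 : ‖Z'‖ ≤ (‖h'‖ + 1) * ‖X‖ := by
    have e1 : Z' = mulOp (fun p => h' (samplePoint s p)) X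
      - (mulOp (fun p => h' (samplePoint s p)) X - Z') := by abel
    have : δ' * ‖X‖ ≤ 1 * ‖X‖ := mul_le_mul_of_nonneg_right (min_le_right _ _) hX
    calc ‖Z'‖ ≤ _ := by conv_lhs => rw [e1]
                        exact norm_sub_le _ _
      _ ≤ ‖h'‖ * ‖X‖ + δ' * ‖X‖ := add_le_add (norm_mulOp_sample_le _ _ _) e'
      _ ≤ _ := by linarith
  have b2 : δ' * ‖X‖ ≤ δ * ‖X‖ := mul_le_mul_of_nonneg_right (min_le_left _ _) hX
  calc _ ≤ _ := norm_add_le _ _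
    _ ≤ ‖h‖ * (δ * ‖X‖) + δ * ((‖h'‖ + 1) * ‖X‖) := by
        refine add_le_add ((norm_mulOp_sample_le _ _ _).trans ?_) (e.trans ?_)
        · exact mul_le_mul_of_nonneg_left (e'.trans b2) (norm_nonneg _)
        · exact mul_le_mul_of_nonneg_left b1 hδ0.le
    _ ≤ δ * (‖h‖ + (‖h'‖ + 1) + 1) * ‖X‖ := by nlinarith [mul_nonneg hδ0.le hX]
    _ = _ := by rw [hδε]

theorem AlmostPreserves.of_approx {h : C(solSphere 3, ℂ)}
    (H : ∀ ε > (0 : ℝ), ∃ h', AlmostPreserves h' ∧ ‖h - h'‖ ≤ ε) : AlmostPreserves h := by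
  intro ε hε D
  obtain ⟨h', H', hh⟩ := H (ε / 2) (by positivity)
  obtain ⟨C, hC⟩ := H' (ε / 2) (by positivity) D
  refine ⟨C, ?_⟩
  filter_upwards [hC] with s h1 x hx
  obtain ⟨z, hz, e⟩ := h1 x hx
  refine ⟨z, hz, ?_⟩
  set X := spread (cubeSide s) x
  set Z := spread (cubeSide s) z
  have : mulOp (fun p => h (samplePoint s p)) X - Z
      = mulOp (fun p => (h - h') (samplePoint s p)) X
      + (mulOp (fun p => h' (samplePoint s p)) X - Z) := by
    ext p; simp [mulOp_apply]; ring
  rw [this]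
  refine (norm_add_le _ _).trans ?_
  have := (norm_mulOp_sample_le (h - h') s X).trans
    (mul_le_mul_of_nonneg_right hh (norm_nonneg _))
  linarith

def coordFun (i : Fin 3) (q : ℚ) : C(solSphere 3, ℂ) :=
  ⟨fun w => w.1 i q,
    (continuous_apply q (A := fun _ : ℚ => ℂ)).comp
      ((continuous_apply i (A := fun _ : Fin 3 => ℚ → ℂ)).comp continuous_subtype_val)⟩

theorem AlmostPreserves.coordFun (i : Fin 3) (q : ℚ) : AlmostPreserves (coordFun i q) := by
  intro ε hε D
  obtain ⟨b, hb⟩ := exists_nat_ge |q|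
  obtain ⟨c, hc⟩ := exists_nat_ge ((128 + 4 * b) / ε ^ 2)
  refine ⟨D + b, ?_⟩
  filter_upwards [Filter.eventually_ge_atTop (2 * D + b + q.den + c)] with s hs x hx
  set m := stepSize s with hm
  have hmpos : 0 < m := stepSize_pos s
  obtain ⟨e, he⟩ : q.den ∣ m := Nat.dvd_factorial q.den_pos (by omega)
  have hqm : q * m = ((q.num * e : ℤ) : ℚ) := by
    rw [he]; push_cast
    rw [← mul_assoc, Rat.mul_den_eq_num]
  have hβ : |q.num * (e : ℤ)| ≤ ((b * m : ℕ) : ℤ) := by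
    have : |q * m| ≤ b * m := by
      rw [abs_mul, abs_of_nonneg (by positivity : (0 : ℚ) ≤ m)]
      gcongr
    rw [hqm] at this
    exact_mod_cast this
  have hDm := mul_stepSize_le (show D ≤ s + 1 by omega)
  have h2Dm := mul_stepSize_le (show 2 * D ≤ s + 1 by omega)
  have hbm := mul_stepSize_le (show b ≤ s + 1 by omega)
  have hLk := cubeSide_le s
  have hL := cubeSide_pos s
  rw [← hm] at hDm hbm h2Dm
  set L := cubeSide s with hLdef
  set k := midLevel s with hk
  have h2K : k ≤ 2 * (k - D * m) := by
    rw [mul_assoc] at h2Dm; omega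
  have hK : 0 < k - D * m := by have := midLevel_pos s; omega
  obtain ⟨z, hz1, hz2⟩ := exists_spread_approx hK i hβ (x := x) (L := L) (fun α hα => by
    refine ⟨?_, fun j => ?_⟩
    · have := (abs_le.1 (hx α hα)).1
      have h3 : ((D * m : ℕ) : ℤ) ≤ k := by exact_mod_cast hDm.trans hLk
      have : (k : ℤ) - (D * m : ℕ) ≤ ((∑ j, (α j).val : ℕ) : ℤ) := by
        push_cast; linarith
      omega
    · have := hx.val_le (by omega) α hα j; omega) hL
  refine ⟨z, fun γ hγ => ?_, ?_⟩
  · obtain ⟨α, hα, h⟩ := hz1 γ hγ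
    calc _ ≤ |(∑ j, ((γ j).val : ℤ)) - ∑ j, ((α j).val : ℤ)|
          + |(∑ j, ((α j).val : ℤ)) - k| := abs_sub_le _ _ _
      _ ≤ (b * m : ℕ) + D * m := add_le_add h (hx α hα)
      _ = _ := by push_cast; ring
  · refine (sq_le_sq₀ (norm_nonneg _) (by positivity)).1 ?_
    have hfun : (fun p => _root_.coordFun i q (samplePoint s p)) = fun p : SampleIndex s =>
        (ratio (fun j => p.1 j) i : ℂ) *
          ZMod.stdAddChar (((q.num * e : ℤ) : ZMod (modulus s)) * p.2 i) := by
      funext p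
      rw [← expChar_sampleAngle hqm]
      exact samplePoint_apply s p i q
    rw [hfun]
    refine hz2.trans ?_
    rw [mul_pow, hx.norm_spread_sq (by omega)]
    rw [mul_left_comm (ε ^ 2), ← mul_assoc (ε ^ 2)]
    refine mul_le_mul_of_nonneg_left (mul_le_mul_of_nonneg_right ?_
      (Finset.sum_nonneg fun _ _ => by positivity)) (by positivity)
    have hs1 : (0 : ℝ) < s + 1 := by positivity
    have hmr : (0 : ℝ) < m := by exact_mod_cast hmpos
    have hLr : (L : ℝ) = (s + 1) * m := by rw [hLdef, cubeSide]; push_cast; rfl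
    have hkr : (k : ℝ) = (s + 1) * L := by rw [hk, midLevel]; push_cast; rfl
    have hLpos : (0 : ℝ) < L := by exact_mod_cast hL
    have hKr : (k : ℝ) / 2 ≤ (k - D * m : ℕ) := by
      have : (k : ℝ) ≤ 2 * (k - D * m : ℕ) := by exact_mod_cast h2K
      linarith
    have hbL : ((b * m : ℕ) : ℝ) ≤ L := by exact_mod_cast hbm
    have h8 : ((3 * L + (b * m : ℕ) : ℝ) / (k - D * m : ℕ)) ≤ 8 / (s + 1) := by
      calc _ ≤ (4 * L : ℝ) / (k / 2) := by
            refine div_le_div₀ (by positivity) (by linarith) ?_ hKr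
            rw [hkr]; positivity
        _ = _ := by rw [hkr]; field_simp; norm_num
    have h8' : ((3 * L + (b * m : ℕ) : ℝ) / (k - D * m : ℕ)) ^ 2 ≤ 64 / (s + 1) := by
      calc _ ≤ (8 / (s + 1) : ℝ) ^ 2 := pow_le_pow_left₀ (by positivity) h8 2
        _ = 64 / (s + 1) / (s + 1) := by field_simp; norm_num
        _ ≤ _ := div_le_self (by positivity) (by
            have : (0 : ℝ) ≤ s := by positivity
            linarith)
    have hBL : (4 : ℝ) * (b * m : ℕ) * L ^ 2 = 4 * b / (s + 1) * L ^ 3 := by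
      push_cast
      have : (m : ℝ) = L / (s + 1) := by rw [hLr]; field_simp
      rw [this]; field_simp
    have hfin : (128 + 4 * b : ℝ) / (s + 1) ≤ ε ^ 2 := by
      rw [div_le_iff₀ hs1]
      rw [div_le_iff₀ (by positivity)] at hc
      have : (c : ℝ) ≤ s + 1 := by
        have : c ≤ s + 1 := by omega
        exact_mod_cast this
      nlinarith [sq_nonneg ε]
    rw [hBL]
    calc _ ≤ 2 * (64 / (s + 1)) * (L : ℝ) ^ 3 + 4 * b / (s + 1) * L ^ 3 := by gcongr
      _ = (128 + 4 * b : ℝ) / (s + 1) * L ^ 3 := by ring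
      _ ≤ _ := by gcongr

theorem solCone.conj_eq {u : ℚ → ℂ} (hu : u ∈ solCone) (q : ℚ) :
    (starRingEnd ℂ) (u q) = u (-q) := by
  by_cases h0 : u 0 = 0
  · have h1 : ∀ q, u q = 0 := fun q => by
      have := solCone.norm_eq hu q
      rw [h0, norm_zero] at this
      exact norm_eq_zero.1 this
    simp [h1]
  · have h1 := hu.2 q (-q)
    rw [add_neg_cancel] at h1
    have h2 := hu.1 q
    have h3 : (starRingEnd ℂ) (u q) * u q = u 0 * u 0 := by
      rw [mul_comm, Complex.mul_conj, Complex.normSq_eq_norm_sq, ← h2]; push_cast; ring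
    have hq : u q ≠ 0 := fun h => h0 (by rw [← h2, h]; simp)
    exact mul_right_cancel₀ hq (by rw [h3, ← h1, mul_comm])

theorem almostPreserves (h : C(solSphere 3, ℂ)) : AlmostPreserves h := by
  let S : Set C(solSphere 3, ℂ) := Set.range fun p : Fin 3 × ℚ => coordFun p.1 p.2
  have hstar : star S ⊆ S := by
    rintro g hg
    obtain ⟨⟨i, q⟩, hi⟩ := Set.mem_star.1 hg
    refine ⟨(i, -q), ?_⟩
    rw [← star_star g, ← hi]
    ext w
    exact (solCone.conj_eq (w.2.1 i) q).symm
  have hA : ∀ g ∈ StarAlgebra.adjoin ℂ S, AlmostPreserves g := by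
    intro g hg
    have hg' : g ∈ Algebra.adjoin ℂ S := by
      have : g ∈ (StarAlgebra.adjoin ℂ S).toSubalgebra := hg
      rw [StarAlgebra.adjoin_toSubalgebra, Set.union_eq_left.2 hstar] at this
      exact this
    clear hg
    induction hg' using Algebra.adjoin_induction with
    | mem x hx => obtain ⟨p, rfl⟩ := hx; exact AlmostPreserves.coordFun _ _
    | algebraMap r => exact AlmostPreserves.const r
    | add x y _ _ hx hy => exact hx.add hy
    | mul x y _ _ hx hy => exact hx.mul hy
  have hsep : (StarAlgebra.adjoin ℂ S).SeparatesPoints := by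
    intro w w' hne
    have : ∃ i q, w.1 i q ≠ w'.1 i q := by
      by_contra! hcon
      exact hne (Subtype.ext (funext fun i => funext fun q => hcon i q))
    obtain ⟨i, q, hiq⟩ := this
    exact ⟨_, ⟨coordFun i q, StarAlgebra.subset_adjoin ℂ S ⟨(i, q), rfl⟩, rfl⟩, hiq⟩
  have htop := ContinuousMap.starSubalgebra_topologicalClosure_eq_top_of_separatesPoints _ hsep
  refine AlmostPreserves.of_approx fun ε hε => ?_
  have hmem : h ∈ closure ((StarAlgebra.adjoin ℂ S : StarSubalgebra ℂ C(solSphere 3, ℂ)) :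
      Set C(solSphere 3, ℂ)) := by
    rw [← StarSubalgebra.topologicalClosure_coe, htop]; trivial
  obtain ⟨g, hg, hd⟩ := Metric.mem_closure_iff.1 hmem ε hε
  exact ⟨g, hA g hg, by rw [← dist_eq_norm]; exact hd.le⟩

end Sampling

section Counting

theorem card_level {N : ℕ} [NeZero N] {e : ℕ} (he : e < N) :
    2 * Fintype.card {α : Fin 3 → ZMod N // ∑ j, (α j).val = e} = (e + 2) * (e + 1) := by
  have h : Fintype.card {α : Fin 3 → ZMod N // ∑ j, (α j).val = e}
      = ((Finset.range (e + 1)).sigma fun x => Finset.range (e + 1 - x)).card := by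
    rw [Fintype.card_subtype]
    refine Finset.card_nbij' (fun α => ⟨(α 0).val, (α 1).val⟩)
      (fun p => ![(p.1 : ZMod N), (p.2 : ZMod N), ((e - p.1 - p.2 : ℕ) : ZMod N)]) ?_ ?_ ?_ ?_
    · intro α hα
      simp [Fin.sum_univ_three] at hα
      simp
      omega
    · rintro ⟨x, y⟩ hp
      simp at hp
      have h1 : x % N = x := Nat.mod_eq_of_lt (by omega)
      have h2 : y % N = y := Nat.mod_eq_of_lt (by omega)
      have h3 : (e - x - y) % N = e - x - y := Nat.mod_eq_of_lt (by omega)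
      simp [Fin.sum_univ_three, ZMod.val_natCast, h1, h2, h3]
      omega
    · intro α hα
      simp [Fin.sum_univ_three] at hα
      have h3 : e - (α 0).val - (α 1).val = (α 2).val := by omega
      funext i
      fin_cases i <;> simp [h3]
    · rintro ⟨x, y⟩ hp
      simp at hp
      have h1 : x % N = x := Nat.mod_eq_of_lt (by omega)
      have h2 : y % N = y := Nat.mod_eq_of_lt (by omega)
      simp [ZMod.val_natCast, h1, h2]
  rw [h, Finset.card_sigma]
  simp only [Finset.card_range]
  clear h he
  induction e with
  | zero => simp
  | succ e ih =>
    rw [Finset.sum_range_succ']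
    simp only [Nat.add_sub_add_right, Nat.sub_zero, mul_add, ih]
    ring

end Counting

section Shift
variable {N : ℕ} [NeZero N]

theorem inner_eq_zero_of_shift {y y' : LatticeSpace N} {c c' : ℂ} (hc' : ‖c'‖ = 1) (hne : c ≠ c')
    (h : ∀ ρ t, y (ρ, t + 1) = c * y (ρ, t)) (h' : ∀ ρ t, y' (ρ, t + 1) = c' * y' (ρ, t)) :
    inner ℂ y' y = 0 := by
  have e : inner ℂ y' y = (starRingEnd ℂ) c' * c * inner ℂ y' y := by
    simp only [PiLp.inner_apply, Fintype.sum_prod_type, Finset.mul_sum]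
    refine Finset.sum_congr rfl fun ρ _ => ?_
    calc _ = ∑ t, inner ℂ (y' (ρ, t + 1)) (y (ρ, t + 1)) :=
          (Equiv.sum_comp (Equiv.addRight (1 : Fin 3 → ZMod N)) _).symm
      _ = _ := Finset.sum_congr rfl fun t _ => by
          simp only [h, h', RCLike.inner_apply, map_mul]; ring
  by_contra h0
  have h1 : (starRingEnd ℂ) c' * c = 1 := mul_right_cancel₀ h0 (by rw [one_mul, ← e])
  have h2 : (starRingEnd ℂ) c' * c' = 1 := by
    rw [mul_comm, Complex.mul_conj, Complex.normSq_eq_norm_sq, hc']; simp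
  have h3 : (starRingEnd ℂ) c' ≠ 0 := left_ne_zero_of_mul (h1.trans_ne one_ne_zero)
  exact hne (mul_left_cancel₀ h3 (h1.trans h2.symm))

theorem spread_shift {L : ℕ} {x : (Fin 3 → ZMod N) → ℂ} {d : ℤ}
    (hx : ∀ α, x α ≠ 0 → ∑ j, ((α j).val : ℤ) = d) (ρ t) :
    spread L x (ρ, t + 1) = ZMod.stdAddChar (d : ZMod N) * spread L x (ρ, t) := by
  rw [spread_apply, spread_apply, Finset.mul_sum]
  refine Finset.sum_congr rfl fun α _ => ?_
  by_cases h : x α = 0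
  · simp [h]
  · have : ∑ j, α j = (d : ZMod N) := by rw [← hx α h]; simp
    rw [phase_add_one, this]; ring

end Shift

theorem expChar_add (c c' : ℝ) (q : ℚ) : expChar (c + c') q = expChar c q * expChar c' q := by
  rw [expChar, expChar, expChar, ← Complex.exp_add]; congr 1; push_cast; ring

theorem apply_samplePoint_shift {h : C(solSphere 3, ℂ)} {a : ℚ}
    (heq : ∀ u ∈ solenoid, ∀ w w' : solSphere 3, (w'.1 = fun i => u * w.1 i) →
      h w' = u (-a) * h w) {s : ℕ} {b : ℤ} (hb : a * stepSize s = b) (ρ t) :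
    h (samplePoint s (ρ, t + 1)) = ZMod.stdAddChar ((-b : ℤ) : ZMod (modulus s))
      * h (samplePoint s (ρ, t)) := by
  let c : ℝ := stepSize s * (((t 0 + 1).val : ℝ) - (t 0).val) / modulus s
  have hc : expChar c (-a) = ZMod.stdAddChar ((-b : ℤ) : ZMod (modulus s)) := by
    have e : ((-b : ℤ) : ZMod (modulus s))
        = ((-b * ((t 0 + 1).val - (t 0).val) : ℤ) : ZMod (modulus s)) := by
      push_cast; simp
    have h' : (a : ℂ) * stepSize s = b := by exact_mod_cast congrArg (Rat.cast : ℚ → ℂ) hb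
    rw [e, ZMod.stdAddChar_coe, expChar]
    congr 1
    simp only [c]
    push_cast
    rw [← h']; ring
  rw [← hc]
  refine heq _ (expChar_mem c) _ _ (funext fun i => funext fun q => ?_)
  rw [Pi.mul_apply, samplePoint_apply, samplePoint_apply, mul_left_comm, ← expChar_add]
  congr 3
  simp only [sampleAngle, c, Pi.add_apply, Pi.one_apply, add_sub_add_right_eq_sub]
  ring

theorem sum_norm_sq_mulOp {s n : ℕ} {h : Fin n → Fin n → C(solSphere 3, ℂ)}
    (hU : ∀ w (ξ : Fin n → ℂ), ∑ j, ‖∑ i, h i j w * ξ i‖ ^ 2 = ∑ i, ‖ξ i‖ ^ 2)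
    (v : Fin n → LatticeSpace (modulus s)) :
    ∑ j, ‖∑ i, mulOp (fun p => h i j (samplePoint s p)) (v i)‖ ^ 2 = ∑ i, ‖v i‖ ^ 2 := by
  simp only [EuclideanSpace.norm_sq_eq]
  rw [Finset.sum_comm, Finset.sum_comm (f := fun i p => ‖v i p‖ ^ 2)]
  refine Finset.sum_congr rfl fun p _ => ?_
  rw [← hU (samplePoint s p) fun i => v i p]
  refine Finset.sum_congr rfl fun j _ => ?_
  simp [mulOp_apply]

theorem spread_eq_sum {s L : ℕ} (z : (Fin 3 → ZMod (modulus s)) → ℂ) :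
    spread L z = ∑ α, z α • spread L (Pi.single α 1) := by
  classical
  conv_lhs => rw [pi_eq_sum_univ' z]
  rw [map_sum]
  refine Finset.sum_congr rfl fun α _ => ?_
  rw [map_smul]

theorem eq_zero_of_orthogonal {n s C : ℕ} {h : Fin n → Fin n → C(solSphere 3, ℂ)}
    (hU : ∀ w (ξ : Fin n → ℂ), ∑ j, ‖∑ i, h i j w * ξ i‖ ^ 2 = ∑ i, ‖ξ i‖ ^ 2)
    {x : Fin n → (Fin 3 → ZMod (modulus s)) → ℂ}
    (happ : ∀ i j, ∃ z, SuppNear s C z ∧ ‖mulOp (fun p => h i j (samplePoint s p))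
      (spread (cubeSide s) (x i)) - spread (cubeSide s) z‖
        ≤ (1 / (n + 1)) * ‖spread (cubeSide s) (x i)‖)
    (horth : ∀ j z, SuppNear s C z → inner ℂ (spread (cubeSide s) z)
      (∑ i, mulOp (fun p => h i j (samplePoint s p)) (spread (cubeSide s) (x i))) = 0) (i : Fin n) :
    spread (cubeSide s) (x i) = 0 := by
  choose z hz1 hz2 using happ
  set v := fun i => spread (cubeSide s) (x i)
  set Φ := fun j => ∑ i, mulOp (fun p => h i j (samplePoint s p)) (v i) with hΦ
  set Q := ∑ i, ‖v i‖ ^ 2 with hQ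
  have hQ0 : 0 ≤ Q := Finset.sum_nonneg fun _ _ => by positivity
  have hsum : ∑ j, ‖Φ j‖ ^ 2 = Q := sum_norm_sq_mulOp hU v
  have hbd : ∀ j, ‖Φ j‖ ≤ (1 / (n + 1)) * ∑ i, ‖v i‖ := by
    intro j
    set Z := ∑ i, spread (cubeSide s) (z i j) with hZ
    have hor : inner ℂ Z (Φ j) = 0 := by
      rw [hZ, sum_inner]
      exact Finset.sum_eq_zero fun i _ => horth j _ (hz1 i j)
    have h1 : ‖Φ j‖ ≤ ‖Φ j - Z‖ := by
      by_cases h0 : ‖Φ j‖ = 0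
      · rw [h0]; exact norm_nonneg _
      · have h2 : inner ℂ (Φ j - Z) (Φ j) = inner ℂ (Φ j) (Φ j) := by
          rw [inner_sub_left, hor, sub_zero]
        have h3 : ‖Φ j‖ * ‖Φ j‖ ≤ ‖Φ j - Z‖ * ‖Φ j‖ := by
          calc _ = ‖inner ℂ (Φ j) (Φ j)‖ := by rw [inner_self_eq_norm_sq_to_K]; simp [sq]
            _ = ‖inner ℂ (Φ j - Z) (Φ j)‖ := by rw [h2]
            _ ≤ _ := norm_inner_le_norm _ _
        exact le_of_mul_le_mul_right h3 (lt_of_le_of_ne (norm_nonneg _) (Ne.symm h0))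
    refine h1.trans ?_
    rw [hΦ, hZ, ← Finset.sum_sub_distrib, Finset.mul_sum]
    exact (norm_sum_le _ _).trans (Finset.sum_le_sum fun i _ => hz2 i j)
  have hcs : (∑ i, ‖v i‖) ^ 2 ≤ n * Q := by
    have := sq_sum_le_card_mul_sum_sq (s := Finset.univ) (f := fun i => ‖v i‖)
    simpa using this
  have hn : (0 : ℝ) < n + 1 := by positivity
  have hQle : Q ≤ n * ((1 / (n + 1)) ^ 2 * (n * Q)) := by
    calc Q = ∑ j, ‖Φ j‖ ^ 2 := hsum.symm
      _ ≤ ∑ j : Fin n, ((1 / (n + 1)) ^ 2 * (n * Q)) := by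
          refine Finset.sum_le_sum fun j _ => ?_
          calc _ ≤ ((1 / (n + 1)) * ∑ i, ‖v i‖) ^ 2 :=
                pow_le_pow_left₀ (norm_nonneg _) (hbd j) 2
            _ ≤ _ := by rw [mul_pow]; gcongr
      _ = _ := by simp
  have hQz : Q = 0 := by
    have e : n * ((1 / (n + 1)) ^ 2 * (n * Q)) = (n : ℝ) ^ 2 * Q / (n + 1) ^ 2 := by field_simp
    rw [e, le_div_iff₀ (by positivity)] at hQle
    have : (0 : ℝ) ≤ n := by positivity
    nlinarith
  have := (Finset.sum_eq_zero_iff_of_nonneg fun i _ => by positivity).1 hQz i (Finset.mem_univ i)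
  exact norm_eq_zero.1 (pow_eq_zero_iff (two_ne_zero) |>.1 this)

theorem sum_level_le {n s C : ℕ} {h : Fin n → Fin n → C(solSphere 3, ℂ)}
    (hU : ∀ w (ξ : Fin n → ℂ), ∑ j, ‖∑ i, h i j w * ξ i‖ ^ 2 = ∑ i, ‖ξ i‖ ^ 2)
    {a : Fin n → ℚ} (heq : ∀ u ∈ solenoid, ∀ w w' : solSphere 3, (w'.1 = fun i => u * w.1 i) →
      ∀ i j, h i j w' = u (-a i) * h i j w)
    {b : Fin n → ℤ} (hb : ∀ i, a i * stepSize s = b i) {D : ℕ} (hD : ∀ i, |a i| ≤ D)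
    (hDs : D ≤ s + 1) (hCs : C ≤ s + 1)
    (happ : ∀ i j, ∀ x, SuppNear s D x → ∃ z, SuppNear s C z ∧
      ‖mulOp (fun p => h i j (samplePoint s p)) (spread (cubeSide s) x) - spread (cubeSide s) z‖
        ≤ (1 / (n + 1)) * ‖spread (cubeSide s) x‖) :
    ∑ i, (midLevel s + b i + 2) * (midLevel s + b i + 1)
      ≤ n * ((midLevel s + 2) * (midLevel s + 1) : ℤ) := by
  classical
  set k := midLevel s with hk
  have hbD : ∀ i, |b i| ≤ (D * stepSize s : ℕ) := by
    intro i
    have : |a i * stepSize s| ≤ D * stepSize s := by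
      rw [abs_mul, abs_of_nonneg (by positivity : (0 : ℚ) ≤ stepSize s)]
      exact mul_le_mul_of_nonneg_right (hD i) (by positivity)
    rw [hb] at this
    exact_mod_cast this
  have hN : modulus s = 4 * k := rfl
  have hkpos : 0 < k := midLevel_pos s
  have hDk := (mul_stepSize_le hDs).trans (cubeSide_le s)
  have hCk := (mul_stepSize_le hCs).trans (cubeSide_le s)
  rw [← hk] at hDk hCk
  have hbk : ∀ i, 0 ≤ k + b i ∧ k + b i ≤ 2 * k := fun i => by
    have := abs_le.1 (hbD i); omega
  let e : Fin n → ℕ := fun i => (k + b i).toNat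
  have he : ∀ i, (e i : ℤ) = k + b i := fun i => Int.toNat_of_nonneg (hbk i).1
  let Lev : ℕ → Type := fun d => {α : Fin 3 → ZMod (modulus s) // ∑ j, (α j).val = d}
  let ext : ∀ i, (Lev (e i) → ℂ) →ₗ[ℂ] ((Fin 3 → ZMod (modulus s)) → ℂ) := fun i =>
    Function.ExtendByZero.linearMap ℂ Subtype.val
  have hext : ∀ i y α, ext i y α ≠ 0 → ∑ j, ((α j).val : ℤ) = k + b i := by
    intro i y α hα
    by_contra hne
    refine hα (Function.extend_apply' _ _ _ ?_)
    rintro ⟨⟨α', hα'⟩, rfl⟩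
    rw [← he i] at hne
    exact hne (by exact_mod_cast hα')
  have hnear : ∀ i y, SuppNear s D (ext i y) := fun i y α hα => by
    rw [hext i y α hα, ← hk, add_sub_cancel_left]
    exact_mod_cast hbD i
  let Φ : Fin n → (∀ i, Lev (e i) → ℂ) →ₗ[ℂ] LatticeSpace (modulus s) := fun j =>
    ∑ i, mulOp (fun p => h i j (samplePoint s p)) ∘ₗ spread (cubeSide s) ∘ₗ ext i
      ∘ₗ LinearMap.proj i
  have hΦ : ∀ j X, Φ j X = ∑ i, mulOp (fun p => h i j (samplePoint s p))
      (spread (cubeSide s) (ext i (X i))) := fun j X => by simp [Φ]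
  let T : (∀ i, Lev (e i) → ℂ) →ₗ[ℂ] (Fin n → Lev k → ℂ) := LinearMap.pi fun j =>
    LinearMap.pi fun α => (innerₛₗ ℂ (spread (cubeSide s) (Pi.single α.1 1))) ∘ₗ Φ j
  have hinj : Function.Injective T := by
    rw [← LinearMap.ker_eq_bot, LinearMap.ker_eq_bot']
    intro X hX
    have hshift : ∀ j ρ t, Φ j X (ρ, t + 1)
        = ZMod.stdAddChar ((k : ℤ) : ZMod (modulus s)) * Φ j X (ρ, t) := by
      intro j ρ t
      rw [hΦ]
      simp only [WithLp.ofLp_sum, Finset.sum_apply, Finset.mul_sum]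
      refine Finset.sum_congr rfl fun i _ => ?_
      rw [mulOp_apply, mulOp_apply, spread_shift (hext i (X i)),
        apply_samplePoint_shift (fun u hu w w' hw => heq u hu w w' hw i j) (hb i)]
      have : (ZMod.stdAddChar ((k : ℤ) : ZMod (modulus s)) : ℂ)
          = ZMod.stdAddChar ((-b i : ℤ) : ZMod (modulus s))
            * ZMod.stdAddChar ((k + b i : ℤ) : ZMod (modulus s)) := by
        rw [← AddChar.map_add_eq_mul]; congr 1; push_cast; ring
      rw [this]; ring
    have horth1 : ∀ j α, |(∑ i, ((α i).val : ℤ)) - k| ≤ C * stepSize s →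
        inner ℂ (spread (cubeSide s) (Pi.single α 1)) (Φ j X) = 0 := by
      intro j α hα
      by_cases hαk : ∑ i, (α i).val = k
      · exact congrFun (congrFun hX j) ⟨α, hαk⟩
      · refine inner_eq_zero_of_shift (norm_stdAddChar _) ?_ (hshift j)
          (spread_shift (d := ∑ i, ((α i).val : ℤ)) fun α' hα' => ?_)
        · intro hc
          have hc := ZMod.injective_stdAddChar hc
          rw [ZMod.intCast_eq_intCast_iff_dvd_sub] at hc
          have h1 : ((C * stepSize s : ℕ) : ℤ) ≤ k := by exact_mod_cast hCk
          have h2 : |(∑ i, ((α i).val : ℤ)) - k| < modulus s := by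
            push_cast at h1
            have hN' : ((modulus s : ℕ) : ℤ) = 4 * k := by exact_mod_cast hN
            have : (0 : ℤ) < k := by exact_mod_cast hkpos
            rw [hN']
            linarith
          have h3 := Int.eq_zero_of_abs_lt_dvd hc h2
          exact hαk (by zify; linarith)
        · by_cases hh : α' = α
          · rw [hh]
          · exact absurd (Pi.single_eq_of_ne hh _) hα'
    have hzero := eq_zero_of_orthogonal (C := C) hU (x := fun i => ext i (X i))
      (fun i j => happ i j _ (hnear i (X i))) (fun j z hz => by
        rw [← hΦ, spread_eq_sum, sum_inner]
        refine Finset.sum_eq_zero fun α _ => ?_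
        rw [inner_smul_left]
        by_cases hα : z α = 0
        · simp [hα]
        · rw [horth1 j α (hz α hα), mul_zero])
    funext i α
    have h1 := (hnear i (X i)).norm_spread_sq hDs
    rw [hzero i, norm_zero] at h1
    have hNpos : (0 : ℝ) < modulus s := by rw [hN]; exact_mod_cast (by omega)
    have hLpos : (0 : ℝ) < cubeSide s := by exact_mod_cast cubeSide_pos s
    have h2 : ∑ α, ‖ext i (X i) α‖ ^ 2 = 0 := by
      have h3 : (0 : ℝ) = (modulus s : ℝ) ^ 3 * (cubeSide s : ℝ) ^ 3 *
          ∑ α, ‖ext i (X i) α‖ ^ 2 := by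
        rw [mul_assoc, ← h1]; simp
      rcases mul_eq_zero.1 h3.symm with h4 | h4
      · exact absurd h4 (by positivity)
      · exact h4
    have h3 := (Finset.sum_eq_zero_iff_of_nonneg fun _ _ => by positivity).1 h2 α.1
      (Finset.mem_univ _)
    have h4 : ext i (X i) α.1 = 0 := norm_eq_zero.1 ((pow_eq_zero_iff two_ne_zero).1 h3)
    have h5 : ext i (X i) α.1 = X i α := Subtype.val_injective.extend_apply _ _ _
    rw [← h5, h4]; rfl
  have hle := LinearMap.finrank_le_finrank_of_injective hinj
  rw [Module.finrank_pi_fintype, Module.finrank_pi_fintype] at hle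
  simp only [Module.finrank_fintype_fun_eq_card] at hle
  have hcard : ∀ d, d < modulus s → (2 * Fintype.card (Lev d) : ℤ) = (d + 2) * (d + 1) :=
    fun d hd => by exact_mod_cast card_level hd
  have h1 : ∀ i, (k + b i + 2) * (k + b i + 1) = 2 * (Fintype.card (Lev (e i)) : ℤ) := by
    intro i
    rw [hcard _ (by have := hbk i; have := he i; omega), he i]
  rw [← hcard k (by omega)]
  simp only [h1, ← Finset.mul_sum]
  have h2 : ((∑ i, Fintype.card (Lev (e i)) : ℕ) : ℤ) ≤
      (∑ j : Fin n, Fintype.card (Lev k) : ℕ) := by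
    exact_mod_cast hle
  push_cast at h2
  simp only [Finset.sum_const, Finset.card_univ, Fintype.card_fin, nsmul_eq_mul] at h2
  linarith

theorem eventually_sum_level_le {n : ℕ} {h : Fin n → Fin n → C(solSphere 3, ℂ)}
    (hU : ∀ w (ξ : Fin n → ℂ), ∑ j, ‖∑ i, h i j w * ξ i‖ ^ 2 = ∑ i, ‖ξ i‖ ^ 2)
    {a : Fin n → ℚ} (heq : ∀ u ∈ solenoid, ∀ w w' : solSphere 3, (w'.1 = fun i => u * w.1 i) →
      ∀ i j, h i j w' = u (-a i) * h i j w) :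
    ∀ᶠ s in Filter.atTop, ∀ b : Fin n → ℤ, (∀ i, a i * stepSize s = b i) →
      ∑ i, (midLevel s + b i + 2) * (midLevel s + b i + 1)
        ≤ n * ((midLevel s + 2) * (midLevel s + 1) : ℤ) := by
  obtain ⟨D, hD⟩ : ∃ D : ℕ, ∀ i, |a i| ≤ D := by
    obtain ⟨D, hD⟩ := exists_nat_ge (∑ i, |a i|)
    exact ⟨D, fun i => (Finset.single_le_sum (f := fun i => |a i|) (fun i _ => abs_nonneg _)
      (Finset.mem_univ i)).trans hD⟩
  choose C hC using fun i j => almostPreserves (h i j) (1 / (n + 1)) (by positivity) D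
  let C' := ∑ i, ∑ j, C i j
  have hCC : ∀ i j, C i j ≤ C' := fun i j =>
    (Finset.single_le_sum (f := fun j => C i j) (fun _ _ => Nat.zero_le _)
      (Finset.mem_univ j)).trans
      (Finset.single_le_sum (f := fun i => ∑ j, C i j) (fun _ _ => Nat.zero_le _)
      (Finset.mem_univ i))
  filter_upwards [Filter.eventually_ge_atTop (D + C'),
    Filter.eventually_all.2 fun i => Filter.eventually_all.2 fun j => hC i j] with s hs hs' b hb
  refine sum_level_le hU heq hb hD (C := C') (by omega) (by omega) fun i j x hx => ?_
  obtain ⟨z, hz, hz'⟩ := hs' i j x hx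
  exact ⟨z, hz.mono (hCC i j), hz'⟩

theorem weights_eq_zero {n : ℕ} {f : Fin n → Fin n → C(solSphere 3, ℂ)}
    (hU : ∀ w (ξ : Fin n → ℂ), ∑ j, ‖∑ i, f i j w * ξ i‖ ^ 2 = ∑ i, ‖ξ i‖ ^ 2)
    {a : Fin n → ℚ} (heq : ∀ u ∈ solenoid, ∀ w w' : solSphere 3, (w'.1 = fun i => u * w.1 i) →
      ∀ i j, f i j w' = u (a i) * f i j w) (i : Fin n) : a i = 0 := by
  have hU' : ∀ w (ξ : Fin n → ℂ), ∑ j, ‖∑ i, (star f i j) w * ξ i‖ ^ 2 = ∑ i, ‖ξ i‖ ^ 2 := by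
    intro w ξ
    have := hU w fun i => (starRingEnd ℂ) (ξ i)
    simp only [RCLike.norm_conj] at this
    rw [← this]
    refine Finset.sum_congr rfl fun j _ => ?_
    rw [← RCLike.norm_conj, map_sum]
    congr 2
    refine Finset.sum_congr rfl fun i _ => ?_
    simp
  have h1 := eventually_sum_level_le (h := f) (a := fun i => -a i) hU
    (by simpa only [neg_neg] using heq)
  have h2 := eventually_sum_level_le (h := star f) (a := a) hU' (by
    intro u hu w w' hw i j
    have := congrArg (starRingEnd ℂ) (heq u hu w w' hw i j)
    rw [map_mul, solCone.conj_eq hu.1] at this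
    exact this)
  obtain ⟨s, h1, h2, h3⟩ := (h1.and (h2.and
    (Filter.eventually_ge_atTop (∑ i, (a i).den)))).exists
  have hden : ∀ i, ∃ b : ℤ, a i * stepSize s = b := by
    intro i
    have : (a i).den ≤ ∑ i, (a i).den :=
      Finset.single_le_sum (f := fun i => (a i).den) (fun _ _ => Nat.zero_le _) (Finset.mem_univ i)
    obtain ⟨e, he⟩ : (a i).den ∣ stepSize s := Nat.dvd_factorial (a i).den_pos (by omega)
    refine ⟨(a i).num * e, ?_⟩
    rw [he]; push_cast
    rw [← mul_assoc, Rat.mul_den_eq_num]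
  choose b hb using hden
  have h1 := h1 (fun i => -b i) fun i => by push_cast; rw [← hb i]; ring
  have h2 := h2 b hb
  set k : ℤ := (midLevel s : ℤ)
  have h4 : ∑ i, b i ^ 2 ≤ 0 := by
    have e : ∑ i, (k + b i + 2) * (k + b i + 1) + ∑ i, (k + -b i + 2) * (k + -b i + 1)
        = 2 * (n * ((k + 2) * (k + 1))) + 2 * ∑ i, b i ^ 2 := by
      rw [← Finset.sum_add_distrib, Finset.mul_sum]
      have : 2 * (n * ((k + 2) * (k + 1))) = ∑ i : Fin n, 2 * ((k + 2) * (k + 1)) := by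
        simp; ring
      rw [this, ← Finset.sum_add_distrib]
      exact Finset.sum_congr rfl fun i _ => by ring
    linarith
  have h5 : b i ^ 2 = 0 := (Finset.sum_eq_zero_iff_of_nonneg fun i _ => sq_nonneg (b i)).1
    (le_antisymm h4 (Finset.sum_nonneg fun i _ => sq_nonneg _)) i (Finset.mem_univ i)
  have h6 : b i = 0 := pow_eq_zero_iff two_ne_zero |>.1 h5
  have h7 := hb i
  rw [h6] at h7
  have := stepSize_pos s
  rcases mul_eq_zero.1 (h7.trans (by simp)) with h | h
  · exact h
  · exfalso
    have : stepSize s = 0 := by exact_mod_cast h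
    omega

/-- The operator sending a vector to the function of its inner products with a continuous family. -/
noncomputable def innerMap {X E : Type*} [TopologicalSpace X] [CompactSpace X]
    [NormedAddCommGroup E] [InnerProductSpace ℂ E] (k : C(X, E)) : E →L[ℂ] C(X, ℂ) :=
  LinearMap.mkContinuous
    { toFun := fun v => ⟨fun x => inner ℂ (k x) v, by fun_prop⟩
      map_add' := fun v w => by ext x; simp
      map_smul' := fun c v => by ext x; simp }
    ‖k‖ fun v => (ContinuousMap.norm_le _ (by positivity)).2 fun x =>
      (norm_inner_le_norm _ _).trans (by gcongr; exact k.norm_coe_le_norm x)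

@[simp] theorem innerMap_apply {X E : Type*} [TopologicalSpace X] [CompactSpace X]
    [NormedAddCommGroup E] [InnerProductSpace ℂ E] (k : C(X, E)) (v : E) (x : X) :
    innerMap k v x = inner ℂ (k x) v := rfl

theorem isCompactOperator_innerMap {X E : Type*} [TopologicalSpace X] [CompactSpace X]
    [NormedAddCommGroup E] [InnerProductSpace ℂ E] [CompleteSpace E] (k : C(X, E)) :
    IsCompactOperator (innerMap k) := by
  refine (isClosed_setOfPred_isCompactOperator (σ₁₂ := RingHom.id ℂ)).closure_subset
    (Metric.mem_closure_iff.2 fun ε hε => ?_)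
  obtain ⟨t, ht, hcov⟩ := Metric.totallyBounded_iff.1
    (isCompact_range k.continuous).totallyBounded (ε / 2) (half_pos hε)
  have : FiniteDimensional ℂ (Submodule.span ℂ t) := FiniteDimensional.span_of_finite ℂ ht
  set W := Submodule.span ℂ t
  refine ⟨innerMap k ∘L W.starProjection, ?_, ?_⟩
  · have : IsCompactOperator W.starProjection :=
      ((isCompactOperator_id (E := W)).comp_clm W.orthogonalProjectionOnto).clm_comp W.subtypeL
    exact this.clm_comp (innerMap k)
  · rw [dist_eq_norm]
    refine (ContinuousLinearMap.opNorm_le_bound _ (half_pos hε).le fun v => ?_).trans_lt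
      (half_lt_self hε)
    refine (ContinuousMap.norm_le _ (by positivity)).2 fun x => ?_
    obtain ⟨y, hy, hxy⟩ := Set.mem_iUnion₂.1 (hcov ⟨x, rfl⟩)
    have hyW : W.starProjection y = y :=
      Submodule.starProjection_eq_self_iff.2 (Submodule.subset_span hy)
    have h1 : ‖k x - W.starProjection (k x)‖ ≤ ε / 2 := by
      rw [Submodule.starProjection_minimal]
      refine (ciInf_le ⟨0, ?_⟩ (⟨y, Submodule.subset_span hy⟩ : W)).trans ?_
      · rintro _ ⟨z, rfl⟩; positivity
      · rw [← dist_eq_norm]; exact (Metric.mem_ball.1 hxy).le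
    have h2 : (innerMap k - innerMap k ∘L W.starProjection) v x
        = inner ℂ (k x - W.starProjection (k x)) v := by
      simp [Submodule.inner_starProjection_left_eq_right]
    rw [h2]
    exact (norm_inner_le_norm _ _).trans (by gcongr)

/-- An operator commuting with a compact symmetric `T` and trivial on the eigenspaces of `T` for
nonzero eigenvalues becomes trivial after applying `T`. -/
theorem apply_eq_of_eqOn_eigenspace {E : Type*} [NormedAddCommGroup E] [InnerProductSpace ℂ E]
    [CompleteSpace E] {T L : E →L[ℂ] E} (hT : IsCompactOperator T) (hT' : T.IsSymmetric)
    (hL : ∀ v, T (L v) = L (T v))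
    (h : ∀ μ : ℂ, μ ≠ 0 → ∀ v, T v = μ • v → L v = v) (v : E) : T (L v) = T v := by
  have key : (⊤ : Submodule ℂ E) ≤ LinearMap.ker ((T ∘L L - T : E →L[ℂ] E) : E →ₗ[ℂ] E) := by
    rw [← (Submodule.topologicalClosure_eq_top_iff).2
      (ContinuousLinearMap.orthogonalComplement_iSup_eigenspaces_eq_bot hT hT')]
    refine Submodule.topologicalClosure_minimal _ (iSup_le fun μ v hv => ?_)
      (ContinuousLinearMap.isClosed_ker _)
    have hv : T v = μ • v := by simpa using Module.End.mem_eigenspace_iff.1 hv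
    by_cases hμ : μ = 0
    · simp [hL, hv, hμ]
    · simp [h μ hμ v hv]
  have := key (Submodule.mem_top (x := v))
  simpa [sub_eq_zero] using this

section HaarConvolution

open MeasureTheory

theorem inner_translate {G : Type*} [Group G] [TopologicalSpace G] [IsTopologicalGroup G]
    [MeasurableSpace G] [BorelSpace G] (μ : MeasureTheory.Measure G) [μ.IsHaarMeasure] (g : G)
    (v w : Lp ℂ 2 μ) :
    inner ℂ (DomMulAct.mk g • v) (DomMulAct.mk g • w) = inner ℂ v w := by
  let L : Lp ℂ 2 μ →ₗᵢ[ℂ] Lp ℂ 2 μ :=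
    ⟨DistribSMul.toLinearMap ℂ _ (DomMulAct.mk g), fun v => DomMulAct.norm_smul_Lp _ v⟩
  exact L.inner_map_map v w

variable {G : Type*} [Group G] [TopologicalSpace G] [IsTopologicalGroup G] [CompactSpace G]
  [MeasurableSpace G] [BorelSpace G] (μ : Measure G) [μ.IsHaarMeasure]

/-- The family of left translates of a continuous function, in `L²`. -/
noncomputable def translates (φ : C(G, ℂ)) : C(G, Lp ℂ 2 μ) where
  toFun x := ContinuousMap.toLp 2 μ ℂ (φ.comp ⟨fun y => x⁻¹ * y, by fun_prop⟩)
  continuous_toFun := (ContinuousMap.toLp 2 μ ℂ).continuous.comp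
    (ContinuousMap.curry (⟨fun p : G × G => φ (p.1⁻¹ * p.2), by fun_prop⟩)).continuous

/-- Convolution with `φ` as an operator on `L²`. -/
noncomputable def convOp (φ : C(G, ℂ)) : Lp ℂ 2 μ →L[ℂ] Lp ℂ 2 μ :=
  ContinuousMap.toLp 2 μ ℂ ∘L innerMap (translates μ φ)

theorem isCompactOperator_convOp (φ : C(G, ℂ)) : IsCompactOperator (convOp μ φ) :=
  (isCompactOperator_innerMap (translates μ φ)).clm_comp (ContinuousMap.toLp 2 μ ℂ)

theorem innerMap_translates_toLp (φ ψ : C(G, ℂ)) (x : G) :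
    innerMap (translates μ φ) (ContinuousMap.toLp 2 μ ℂ ψ) x
      = ∫ y, ψ y * (starRingEnd ℂ) (φ (x⁻¹ * y)) ∂μ := by
  rw [innerMap_apply, translates, ContinuousMap.coe_mk, ContinuousMap.inner_toLp]
  rfl

theorem isSymmetric_convOp {φ : C(G, ℂ)}
    (hφ : ∀ x, φ x⁻¹ = (starRingEnd ℂ) (φ x)) : (convOp μ φ).IsSymmetric := by
  have hd := ContinuousMap.toLp_denseRange ℂ μ ℂ (p := 2) (by simp)
  intro v w
  refine hd.induction_on₂ (p := fun v w => inner ℂ (convOp μ φ v) w = inner ℂ v (convOp μ φ w))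
    (isClosed_eq (by fun_prop) (by fun_prop)) (fun f g => ?_) v w
  simp only [convOp, ContinuousLinearMap.comp_apply, ContinuousMap.inner_toLp,
    innerMap_translates_toLp, ← integral_conj, ← integral_const_mul, ← integral_mul_const]
  rw [integral_integral_swap_of_hasCompactSupport (by fun_prop) (.of_compactSpace _)]
  refine integral_congr_ae (.of_forall fun x => integral_congr_ae (.of_forall fun y => ?_))
  have : φ (y⁻¹ * x) = (starRingEnd ℂ) (φ (x⁻¹ * y)) := by rw [← hφ]; simp
  simp only [map_mul, this, Complex.conj_conj]
  ring

theorem innerMap_translates_smul (φ : C(G, ℂ)) (g x : G) (v : Lp ℂ 2 μ) :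
    innerMap (translates μ φ) (DomMulAct.mk g • v) x = innerMap (translates μ φ) v (g * x) := by
  rw [innerMap_apply, innerMap_apply, ← inner_translate μ g _ v]
  congr 1
  change ContinuousMap.toLp 2 μ ℂ _ = DomMulAct.mk g • (ContinuousMap.toLp 2 μ ℂ _)
  refine (Lp.ext ?_)
  refine (ContinuousMap.coeFn_toLp μ _).trans (.trans ?_ (DomMulAct.smul_Lp_ae_eq _ _).symm)
  have := (measurePreserving_smul g μ).quasiMeasurePreserving.ae_eq_comp
    (ContinuousMap.coeFn_toLp (p := 2) (𝕜 := ℂ) μ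
      (φ.comp ⟨fun y => (g * x)⁻¹ * y, by fun_prop⟩))
  refine .trans (.of_forall fun y => ?_) this.symm
  simp [mul_assoc]

theorem convOp_smul (φ : C(G, ℂ)) (g : G) (v : Lp ℂ 2 μ) :
    convOp μ φ (DomMulAct.mk g • v) = DomMulAct.mk g • convOp μ φ v := by
  change ContinuousMap.toLp 2 μ ℂ _ = DomMulAct.mk g • (ContinuousMap.toLp 2 μ ℂ _)
  refine (Lp.ext ?_)
  refine (ContinuousMap.coeFn_toLp μ _).trans (.trans ?_ (DomMulAct.smul_Lp_ae_eq _ _).symm)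
  have := (measurePreserving_smul g μ).quasiMeasurePreserving.ae_eq_comp
    (ContinuousMap.coeFn_toLp (p := 2) (𝕜 := ℂ) μ (innerMap (translates μ φ) v))
  refine .trans (.of_forall fun y => ?_) this.symm
  exact innerMap_translates_smul μ φ g y v

end HaarConvolution

/-- A finite-dimensional invariant subspace of a strongly continuous unitary representation yields a
continuous representation by unitary matrices. -/
theorem exists_matrix_of_invariant {G E : Type*} [Group G] [TopologicalSpace G]
    [NormedAddCommGroup E] [InnerProductSpace ℂ E] (τ : G →* (E →ₗ[ℂ] E))
    (hτ : ∀ x v w, inner ℂ (τ x v) (τ x w) = inner ℂ v w) (hc : ∀ v, Continuous fun x => τ x v)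
    (W : Submodule ℂ E) [FiniteDimensional ℂ W] (hW : ∀ x, ∀ v ∈ W, τ x v ∈ W) :
    ∃ (n : ℕ) (ρ : G →* Matrix (Fin n) (Fin n) ℂ), Continuous ρ ∧
      (∀ x, ρ x ∈ Matrix.unitaryGroup (Fin n) ℂ) ∧ ∀ x, ρ x = 1 → ∀ v ∈ W, τ x v = v := by
  let b := stdOrthonormalBasis ℂ W
  have hexp : ∀ x j, τ x (b j) = ∑ k, inner ℂ (b k : E) (τ x (b j)) • (b k : E) := fun x j => by
    have := b.sum_repr' ⟨τ x (b j), hW x _ (b j).2⟩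
    simpa using (congrArg Subtype.val this).symm
  have h1 : ∀ i j, inner ℂ (b i : E) (b j : E) = (1 : Matrix _ _ ℂ) i j := fun i j => by
    rw [Matrix.one_apply, ← Submodule.coe_inner, orthonormal_iff_ite.1 b.orthonormal]
  let ρ : G →* Matrix (Fin (Module.finrank ℂ W)) (Fin (Module.finrank ℂ W)) ℂ :=
    { toFun := fun x => .of fun i j => inner ℂ (b i : E) (τ x (b j))
      map_one' := by ext i j; simpa using h1 i j
      map_mul' := fun x y => by
        ext i j
        rw [Matrix.mul_apply]
        simp only [Matrix.of_apply, map_mul, Module.End.mul_apply]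
        conv_lhs => rw [hexp y j]
        simp only [map_sum, map_smul, inner_sum, inner_smul_right, mul_comm] }
  have hρ : ∀ x i j, ρ x i j = inner ℂ (b i : E) (τ x (b j)) := fun _ _ _ => rfl
  refine ⟨_, ρ, ?_, fun x => ?_, fun x hx v hv => ?_⟩
  · exact continuous_matrix fun i j => by
      simp only [hρ]; exact continuous_const.inner (hc _)
  · rw [Matrix.mem_unitaryGroup_iff']
    have : star (ρ x) = ρ x⁻¹ := by
      ext i j
      rw [Matrix.star_apply, hρ, hρ, ← hτ x _ (τ x⁻¹ (b j)), ← Module.End.mul_apply, ← map_mul]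
      simp
    rw [this, ← map_mul, inv_mul_cancel, map_one]
  · have hb : ∀ j, τ x (b j) = b j := fun j => by
      rw [hexp x j]
      simp only [← hρ, hx, Matrix.one_apply, ite_smul, one_smul, zero_smul]
      simp
    have := congrArg Subtype.val (b.sum_repr' ⟨v, hv⟩)
    simp only [Submodule.coe_sum, Submodule.coe_smul] at this
    rw [← this]
    simp [hb]

/-- There is a Hermitian continuous function positive at `1` whose supports around `1` and `g` are
disjoint. -/
theorem exists_symmetric_bump {G : Type*} [Group G] [TopologicalSpace G] [IsTopologicalGroup G]
    [CompactSpace G] [T2Space G] {g : G} (hg : g ≠ 1) :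
    ∃ φ : C(G, ℂ), (∀ x, φ x⁻¹ = (starRingEnd ℂ) (φ x)) ∧ φ 1 ≠ 0 ∧
      ∀ x, φ x * (starRingEnd ℂ) (φ (g * x)) = 0 := by
  obtain ⟨U₁, U₂, hU₁, hU₂, h1, hgU, hd⟩ := t2_separation hg.symm
  set V : Set G := U₁ ∩ (fun x => g * x) ⁻¹' U₂
  have hV : IsOpen V := hU₁.inter (hU₂.preimage (by fun_prop))
  obtain ⟨ψ, hψ0, hψ1, -⟩ := exists_continuous_zero_one_of_isClosed hV.isClosed_compl
    (isClosed_singleton (x := (1 : G))) (by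
      rw [Set.disjoint_singleton_right, Set.mem_compl_iff, not_not]
      exact ⟨h1, by simpa using hgU⟩)
  refine ⟨⟨fun x => ((ψ x * ψ x⁻¹ : ℝ) : ℂ), by fun_prop⟩, fun x => ?_, ?_, fun x => ?_⟩
  · simp [mul_comm]
  · have := hψ1 (Set.mem_singleton (1 : G))
    simp_all
  · by_cases hx : x ∈ V
    · have : g * x ∉ V := fun h => hd.ne_of_mem h.1 hx.2 rfl
      have := hψ0 this
      simp_all
    · have := hψ0 hx
      simp_all

open MeasureTheory in
/-- Finite-dimensional continuous unitary representations separate the points of a compact group. -/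
theorem exists_unitary_rep_ne_one {G : Type*} [Group G] [TopologicalSpace G]
    [IsTopologicalGroup G] [CompactSpace G] [T2Space G] {g : G} (hg : g ≠ 1) :
    ∃ (n : ℕ) (ρ : G →* Matrix (Fin n) (Fin n) ℂ), Continuous ρ ∧
      (∀ x, ρ x ∈ Matrix.unitaryGroup (Fin n) ℂ) ∧ ρ g ≠ 1 := by
  by_contra! hcon
  borelize G
  let μ : Measure G := Measure.haar
  have : Fact ((2 : ENNReal) ≠ ⊤) := ⟨by simp⟩
  let τ : G →* (Lp ℂ 2 μ →ₗ[ℂ] Lp ℂ 2 μ) :=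
    { toFun := fun x => DistribSMul.toLinearMap ℂ _ (DomMulAct.mk x⁻¹)
      map_one' := by ext1 v; simp
      map_mul' := fun x y => by
        ext1 v; simp [mul_smul] }
  have hτ : ∀ x v, τ x v = DomMulAct.mk x⁻¹ • v := fun _ _ => rfl
  obtain ⟨φ, hφ, hφ1, hφg⟩ := exists_symmetric_bump hg
  set T := convOp μ φ
  have hT := isCompactOperator_convOp μ φ
  have hτT : ∀ x v, T (τ x v) = τ x (T v) := fun x v => convOp_smul μ φ _ _
  have key := apply_eq_of_eqOn_eigenspace (T := T)
    (L := LinearMap.mkContinuous (τ g) 1 fun v => by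
      rw [hτ, DomMulAct.norm_smul_Lp, one_mul]) hT (isSymmetric_convOp μ hφ) (hτT g) (by
    intro c hc v hv
    have := ContinuousLinearMap.finite_dimensional_eigenspace hT c hc
    obtain ⟨n, ρ, h1, h2, h3⟩ := exists_matrix_of_invariant τ
      (fun x v w => inner_translate μ _ v w)
      (fun v => by
        simp only [hτ]
        exact (DomMulAct.continuous_mk.comp continuous_inv).smul continuous_const)
      (Module.End.eigenspace T.toLinearMap c) (fun x v hv => by
        rw [Module.End.mem_eigenspace_iff] at hv ⊢
        have hv : T v = c • v := hv
        change T (τ x v) = _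
        rw [hτT, hv, map_smul])
    exact h3 g (hcon n ρ h1 h2) v (Module.End.mem_eigenspace_iff.2 hv))
    (ContinuousMap.toLp 2 μ ℂ φ)
  have key := DFunLike.congr_fun (ContinuousMap.toLp_injective μ key) 1
  have e : innerMap (translates μ φ) (DomMulAct.mk g⁻¹ • ContinuousMap.toLp 2 μ ℂ φ) 1
    = innerMap (translates μ φ) (ContinuousMap.toLp 2 μ ℂ φ) 1 := key
  rw [innerMap_translates_smul, innerMap_translates_toLp, innerMap_translates_toLp] at e
  simp only [mul_one, inv_inv, hφg, MeasureTheory.integral_zero, inv_one, one_mul] at e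
  rw [← ContinuousMap.inner_toLp, eq_comm, inner_self_eq_zero] at e
  exact hφ1 (by simpa using DFunLike.congr_fun (ContinuousMap.toLp_injective μ
    (e.trans (map_zero _).symm)) 1)

/-- A unitary matrix is unitarily diagonalizable. -/
theorem exists_unitary_diagonalization {n : ℕ} {U : Matrix (Fin n) (Fin n) ℂ}
    (hU : U ∈ Matrix.unitaryGroup (Fin n) ℂ) :
    ∃ P ∈ Matrix.unitaryGroup (Fin n) ℂ, ∃ d : Fin n → ℂ,
      P * U = Matrix.diagonal d * P := by
  classical
  have h1 : U * star U = 1 := Matrix.mem_unitaryGroup_iff.1 hU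
  have h2 : star U * U = 1 := Matrix.mem_unitaryGroup_iff'.1 hU
  set A := Matrix.toEuclideanLin (U + star U)
  set B := Matrix.toEuclideanLin (Complex.I • (U - star U))
  have hA : A.IsSymmetric := Matrix.isSymmetric_toEuclideanLin_iff.2 (by
    rw [Matrix.IsHermitian, ← Matrix.star_eq_conjTranspose, star_add, star_star, add_comm])
  have hB : B.IsSymmetric := Matrix.isSymmetric_toEuclideanLin_iff.2 (by
    rw [Matrix.IsHermitian, ← Matrix.star_eq_conjTranspose, star_smul, star_sub, star_star]
    simp [← smul_neg])
  have hAB : Commute A B := by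
    have : (U + star U) * (Complex.I • (U - star U)) =
        (Complex.I • (U - star U)) * (U + star U) := by
      simp only [mul_smul_comm, smul_mul_assoc, add_mul, mul_sub, sub_mul, mul_add, h1, h2]
      module
    have := congrArg Matrix.toEuclideanLin this
    rwa [Matrix.toLpLin_mul_same, Matrix.toLpLin_mul_same] at this
  have hinteg' := hA.directSum_isInternal_of_commute hB hAB
  have horth' := LinearMap.IsSymmetric.orthogonalFamily_eigenspace_inf_eigenspace hA hB
  have hinteg := DirectSum.isInternal_ne_bot_iff.2 hinteg'
  have := hinteg'.submodule_iSupIndep.fintypeNeBotOfFiniteDimensional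
  have horth := horth'.comp (Subtype.val_injective (p := fun i : ℂ × ℂ =>
    Module.End.eigenspace A i.2 ⊓ Module.End.eigenspace B i.1 ≠ ⊥))
  have hn : Module.finrank ℂ (EuclideanSpace ℂ (Fin n)) = n := by simp
  let b := hinteg.subordinateOrthonormalBasis hn horth
  have hb : ∀ i, ∃ c : ℂ, U.mulVec (b i).ofLp = c • (b i).ofLp := by
    intro i
    obtain ⟨e1, e2⟩ := hinteg.subordinateOrthonormalBasis_subordinate hn i horth
    set p := (hinteg.subordinateOrthonormalBasisIndex hn i horth).1
    rw [SetLike.mem_coe, Module.End.mem_eigenspace_iff] at e1 e2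
    have e1 : (U + star U).mulVec (b i).ofLp = p.2 • (b i).ofLp := congrArg WithLp.ofLp e1
    have e2 : (Complex.I • (U - star U)).mulVec (b i).ofLp = p.1 • (b i).ofLp :=
      congrArg WithLp.ofLp e2
    refine ⟨(p.2 - Complex.I * p.1) / 2, ?_⟩
    have : U = (2⁻¹ : ℂ) • (U + star U) - (Complex.I / 2) • (Complex.I • (U - star U)) := by
      rw [smul_smul, show Complex.I / 2 * Complex.I = -(2⁻¹ : ℂ) by
        rw [div_mul_eq_mul_div, Complex.I_mul_I]; ring]
      module
    rw [this, Matrix.sub_mulVec, Matrix.smul_mulVec, Matrix.smul_mulVec, e1, e2]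
    module
  choose d hd using hb
  let P : Matrix (Fin n) (Fin n) ℂ := .of fun i j => star ((b i).ofLp j)
  have hP : P * star P = 1 := by
    ext i j
    have := orthonormal_iff_ite.1 b.orthonormal i j
    rw [PiLp.inner_apply] at this
    rw [Matrix.mul_apply, Matrix.one_apply, ← this]
    simp [P, mul_comm]
  have hP' : P ∈ Matrix.unitaryGroup (Fin n) ℂ := Matrix.mem_unitaryGroup_iff.2 hP
  refine ⟨P, hP', d, ?_⟩
  have key : U * star P = star P * Matrix.diagonal d := by
    ext j i
    have := congrFun (hd i) j
    rw [Matrix.mul_diagonal, Matrix.mul_apply]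
    simpa [P, Matrix.mulVec, dotProduct, mul_comm] using this
  calc P * U = P * (U * star P) * P := by
        rw [Matrix.mul_assoc, Matrix.mul_assoc, Matrix.mem_unitaryGroup_iff'.1 hP', Matrix.mul_one]
    _ = _ := by rw [key, ← Matrix.mul_assoc, hP, Matrix.one_mul]

theorem norm_eq_one_of_diagonalization {n : ℕ} {U P : Matrix (Fin n) (Fin n) ℂ}
    (hU : U ∈ Matrix.unitaryGroup (Fin n) ℂ) (hP : P ∈ Matrix.unitaryGroup (Fin n) ℂ)
    {d : Fin n → ℂ} (h : P * U = Matrix.diagonal d * P) (i : Fin n) : ‖d i‖ = 1 := by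
  have hD : Matrix.diagonal d ∈ Matrix.unitaryGroup (Fin n) ℂ := by
    have : Matrix.diagonal d = P * U * star P := by
      rw [h, Matrix.mul_assoc, Matrix.mem_unitaryGroup_iff.1 hP, Matrix.mul_one]
    rw [this]
    exact mul_mem (mul_mem hP hU) (Unitary.star_mem hP)
  have := congrFun (congrFun (Matrix.mem_unitaryGroup_iff.1 hD) i) i
  rw [Matrix.star_eq_conjTranspose, Matrix.diagonal_conjTranspose,
    Matrix.diagonal_mul_diagonal] at this
  simp only [Matrix.diagonal_apply_eq, Pi.star_apply, Matrix.one_apply_eq] at this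
  rw [RCLike.star_def, Complex.mul_conj] at this
  have h2 : Complex.normSq (d i) = 1 := by exact_mod_cast this
  rw [Complex.normSq_eq_norm_sq] at h2
  exact (pow_eq_one_iff_of_nonneg (norm_nonneg _) two_ne_zero).1 h2

theorem trace_of_diagonalization {n : ℕ} {U P : Matrix (Fin n) (Fin n) ℂ}
    (hP : P ∈ Matrix.unitaryGroup (Fin n) ℂ) {d : Fin n → ℂ}
    (h : P * U = Matrix.diagonal d * P) : U.trace = ∑ i, d i := by
  have : U = star P * (Matrix.diagonal d * P) := by
    rw [← h, ← Matrix.mul_assoc, Matrix.mem_unitaryGroup_iff'.1 hP, Matrix.one_mul]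
  rw [this, Matrix.trace_mul_comm, Matrix.mul_assoc, Matrix.mem_unitaryGroup_iff.1 hP,
    Matrix.mul_one, Matrix.trace_diagonal]

theorem eq_one_of_trace_eq {n : ℕ} {U : Matrix (Fin n) (Fin n) ℂ}
    (hU : U ∈ Matrix.unitaryGroup (Fin n) ℂ) (htr : U.trace = n) : U = 1 := by
  obtain ⟨P, hP, d, hd⟩ := exists_unitary_diagonalization hU
  have hnorm := norm_eq_one_of_diagonalization hU hP hd
  rw [trace_of_diagonalization hP hd] at htr
  have hsum : ∑ i, (1 - (d i).re) = 0 := by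
    have := congrArg Complex.re htr
    simp at this
    simp [this]
  have hre : ∀ i, (d i).re = 1 := fun i => by
    have := (Finset.sum_eq_zero_iff_of_nonneg fun i _ => by
      have := Complex.re_le_norm (d i)
      rw [hnorm] at this; linarith).1 hsum i (Finset.mem_univ i)
    linarith
  have hd1 : d = fun _ => 1 := funext fun i => by
    have h1 := Complex.normSq_eq_norm_sq (d i)
    rw [hnorm, Complex.normSq_apply, hre] at h1
    exact Complex.ext (hre i) (by simpa using h1)
  have : P * U = P := by rw [hd, hd1]; simp
  calc U = star P * (P * U) := by
        rw [← Matrix.mul_assoc, Matrix.mem_unitaryGroup_iff'.1 hP, Matrix.one_mul]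
    _ = 1 := by rw [this, Matrix.mem_unitaryGroup_iff'.1 hP]

/-- A nontrivial unitary representation of a connected group takes a value having an eigenvalue of
infinite order. -/
theorem exists_eigenvalue_infinite_order {G : Type*} [Group G] [TopologicalSpace G]
    [PreconnectedSpace G] {n : ℕ} {ρ : G →* Matrix (Fin n) (Fin n) ℂ} (hρ : Continuous ρ)
    (hU : ∀ x, ρ x ∈ Matrix.unitaryGroup (Fin n) ℂ) {g : G} (hg : ρ g ≠ 1) :
    ∃ x, ∃ P ∈ Matrix.unitaryGroup (Fin n) ℂ, ∃ d : Fin n → ℂ,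
      P * ρ x = Matrix.diagonal d * P ∧ ∃ i, ∀ m > 0, d i ^ m ≠ 1 := by
  by_contra! hcon
  set R : Set ℂ := ⋃ m : ℕ, {z | 0 < m ∧ z ^ m = 1}
  have hR : R.Countable := Set.countable_iUnion fun m => by
    refine Set.Finite.countable ?_
    rcases Nat.eq_zero_or_pos m with rfl | hm
    · simp
    · refine (Polynomial.nthRootsFinset m (1 : ℂ)).finite_toSet.subset fun z hz => ?_
      exact (Polynomial.mem_nthRootsFinset hm _).2 hz.2
  have hS : ((fun d : Fin n → ℂ => ∑ i, d i) '' Set.pi Set.univ fun _ => R).Countable :=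
    (Set.countable_univ_pi fun _ => hR).image _
  have hsub : (Set.range fun x => (ρ x).trace) ⊆
      (fun d : Fin n → ℂ => ∑ i, d i) '' Set.pi Set.univ fun _ => R := by
    rintro _ ⟨x, rfl⟩
    obtain ⟨P, hP, d, hd⟩ := exists_unitary_diagonalization (hU x)
    refine ⟨d, fun i _ => ?_, (trace_of_diagonalization hP hd).symm⟩
    obtain ⟨m, hm, e⟩ := hcon x P hP d hd i
    exact Set.mem_iUnion.2 ⟨m, hm, e⟩
  have hconst := hS.isTotallyDisconnected _ hsub (isPreconnected_range hρ.matrix_trace)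
  refine hg (eq_one_of_trace_eq (hU g) ?_)
  have : (ρ g).trace = (ρ 1).trace := hconst ⟨g, rfl⟩ ⟨1, rfl⟩
  simpa using this

/-- A continuous unitary representation is simultaneously diagonal on the closed subgroup generated
by one element. -/
theorem exists_characters {G : Type*} [Group G] [TopologicalSpace G] [IsTopologicalGroup G]
    {n : ℕ} {ρ : G →* Matrix (Fin n) (Fin n) ℂ} (hρ : Continuous ρ)
    (hU : ∀ x, ρ x ∈ Matrix.unitaryGroup (Fin n) ℂ) {g : G} {P : Matrix (Fin n) (Fin n) ℂ}
    (hP : P ∈ Matrix.unitaryGroup (Fin n) ℂ) {d : Fin n → ℂ}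
    (hd : P * ρ g = Matrix.diagonal d * P) :
    ∃ χ : Fin n → ((Subgroup.zpowers g).topologicalClosure →ₜ* Circle),
      ∀ k : (Subgroup.zpowers g).topologicalClosure,
        P * ρ k = Matrix.diagonal (fun i => (χ i k : ℂ)) * P := by
  have hPP := Matrix.mem_unitaryGroup_iff.1 hP
  have hPP' := Matrix.mem_unitaryGroup_iff'.1 hP
  let σ : G →* Matrix (Fin n) (Fin n) ℂ :=
    { toFun := fun x => P * ρ x * star P
      map_one' := by simp [hPP]
      map_mul' := fun x y => by
        rw [map_mul, show P * ρ x * star P * (P * ρ y * star P)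
          = P * ρ x * (star P * P) * ρ y * star P by simp only [Matrix.mul_assoc], hPP',
          Matrix.mul_one]
        simp only [Matrix.mul_assoc] }
  have hσ : Continuous σ := (continuous_const.mul hρ).mul continuous_const
  have hσP : ∀ x, P * ρ x = σ x * P := fun x => by
    change _ = P * ρ x * star P * P
    rw [Matrix.mul_assoc _ (star P), hPP', Matrix.mul_one]
  let S : Subgroup G :=
    { carrier := {x | ∀ i j, i ≠ j → σ x i j = 0}
      one_mem' := fun i j hij => by simp [hij]
      mul_mem' := fun {x y} hx hy i j hij => by
        rw [map_mul, Matrix.mul_apply]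
        refine Finset.sum_eq_zero fun l _ => ?_
        by_cases h : i = l
        · rw [hy l j (h ▸ hij), mul_zero]
        · rw [hx i l h, zero_mul]
      inv_mem' := fun {x} hx i j hij => by
        have h1 : σ x⁻¹ = star (σ x) := by
          have h2 : σ x * star (σ x) = 1 := by
            refine Matrix.mem_unitaryGroup_iff.1 ?_
            exact mul_mem (mul_mem hP (hU x)) (Unitary.star_mem hP)
          calc σ x⁻¹ = σ x⁻¹ * (σ x * star (σ x)) := by rw [h2, Matrix.mul_one]
            _ = star (σ x) := by
              rw [← Matrix.mul_assoc, ← map_mul, inv_mul_cancel, map_one, Matrix.one_mul]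
        rw [h1, Matrix.star_apply, hx j i hij.symm, star_zero] }
  have hclosed : IsClosed (S : Set G) := by
    have : (S : Set G) = ⋂ i, ⋂ j, ⋂ _ : i ≠ j, {x | σ x i j = 0} := by
      ext x; simp [S]
    rw [this]
    exact isClosed_iInter fun i => isClosed_iInter fun j => isClosed_iInter fun _ =>
      isClosed_eq (hσ.matrix_elem i j) continuous_const
  have hle : (Subgroup.zpowers g).topologicalClosure ≤ S := by
    refine Subgroup.topologicalClosure_minimal _ ?_ hclosed
    rw [Subgroup.zpowers_le]
    intro i j hij
    change (P * ρ g * star P) i j = 0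
    rw [hd, Matrix.mul_assoc, hPP, Matrix.mul_one, Matrix.diagonal_apply_ne _ hij]
  have hdiag : ∀ k : (Subgroup.zpowers g).topologicalClosure,
      σ k = Matrix.diagonal fun i => σ k i i := fun k => by
    ext i j
    by_cases hij : i = j
    · subst hij; simp
    · rw [Matrix.diagonal_apply_ne _ hij, hle k.2 i j hij]
  have hnorm : ∀ (k : (Subgroup.zpowers g).topologicalClosure) i, ‖σ k i i‖ = 1 := fun k i =>
    norm_eq_one_of_diagonalization (hU k) hP (d := fun i => σ k i i) (by rw [← hdiag, hσP]) i
  let c : Fin n → (Subgroup.zpowers g).topologicalClosure → Circle := fun i k =>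
    ⟨σ k i i, by simpa [Submonoid.unitSphere] using hnorm k i⟩
  have hc : ∀ i k, (c i k : ℂ) = σ k i i := fun _ _ => rfl
  refine ⟨fun i => ⟨⟨⟨c i, ?_⟩, ?_⟩, ?_⟩, fun k => ?_⟩
  · ext; simp [hc]
  · intro k l
    ext
    rw [Circle.coe_mul, hc, hc, hc, Subgroup.coe_mul, map_mul, hdiag k, hdiag l,
      Matrix.diagonal_mul_diagonal]
    simp
  · exact Continuous.subtype_mk ((hσ.matrix_elem i i).comp continuous_subtype_val) _
  · rw [hσP, hdiag k]
    rfl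

theorem isInducing_circle_coe : IsInducing fun z : Circle => (z : ℂ) :=
  IsInducing.subtypeVal

section Duality

open MeasureTheory

variable {K : Type*} [Group K] [TopologicalSpace K] [IsTopologicalGroup K]

theorem integral_character_eq_zero [MeasurableSpace K] [BorelSpace K] (μ : Measure K)
    [μ.IsMulLeftInvariant] {χ : K →ₜ* Circle} (hχ : χ ≠ 1) : ∫ k, (χ k : ℂ) ∂μ = 0 := by
  obtain ⟨k₀, hk₀⟩ : ∃ k₀, χ k₀ ≠ 1 := by
    by_contra! h
    exact hχ (ContinuousMonoidHom.ext h)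
  have h1 := integral_mul_left_eq_self (μ := μ) (fun k => (χ k : ℂ)) k₀
  simp only [map_mul, Circle.coe_mul, integral_const_mul] at h1
  have h2 : ((χ k₀ : ℂ) - 1) * ∫ k, (χ k : ℂ) ∂μ = 0 := by rw [sub_mul, h1, one_mul, sub_self]
  refine (mul_eq_zero.1 h2).resolve_left fun h => hk₀ ?_
  exact Circle.ext (by simpa [sub_eq_zero] using h)

/-- Every homomorphism from the character group of a compact group to the circle is the evaluation
at some point. -/
theorem exists_eq_eval [CompactSpace K] [T2Space K] (θ : (K →ₜ* Circle) →* Circle) :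
    ∃ k, ∀ χ, χ k = θ χ := by
  borelize K
  let Γ := K →ₜ* Circle
  let X := {η : Γ → Circle // ∀ a b, η (a * b) = η a * η b}
  have hclosed : IsClosed {η : Γ → Circle | ∀ a b, η (a * b) = η a * η b} := by
    simp only [Set.ofPred_forall]
    exact isClosed_iInter fun a => isClosed_iInter fun b => isClosed_eq (by fun_prop) (by fun_prop)
  have : CompactSpace X := isCompact_iff_compactSpace.1 hclosed.isCompact
  let e : Γ →* C(X, ℂ) :=
    { toFun := fun γ => ⟨fun η => (η.1 γ : ℂ),
        isInducing_circle_coe.continuous.comp ((continuous_apply γ).comp continuous_subtype_val)⟩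
      map_one' := by
        ext η
        have : η.1 1 = 1 := by simpa using η.2 1 1
        exact congrArg (fun z : Circle => (z : ℂ)) this
      map_mul' := fun a b => by ext η; simp [η.2 a b] }
  have he : ∀ γ (η : X), e γ η = (η.1 γ : ℂ) := fun _ _ => rfl
  have hes : ∀ γ, star (e γ) = e γ⁻¹ := fun γ => by
    have h1 : e γ⁻¹ * e γ = 1 := by rw [← map_mul, inv_mul_cancel, map_one]
    have h2 : e γ * star (e γ) = 1 := by
      ext η
      simp only [he, ContinuousMap.mul_apply, ContinuousMap.star_apply, ContinuousMap.one_apply,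
        RCLike.star_def, Complex.mul_conj, Circle.normSq_coe, Complex.ofReal_one]
    exact (left_inv_eq_right_inv h1 h2).symm
  let A : StarSubalgebra ℂ C(X, ℂ) :=
    { toSubalgebra := Algebra.adjoin ℂ (Set.range e)
      star_mem' := by
        change Algebra.adjoin ℂ (Set.range e) ≤ star (Algebra.adjoin ℂ (Set.range e))
        refine Algebra.adjoin_le ?_
        rintro _ ⟨γ, rfl⟩
        exact Algebra.subset_adjoin ⟨γ⁻¹, (hes γ).symm⟩ }
  have hA : A.toSubalgebra.toSubmodule = Submodule.span ℂ (Set.range e) := by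
    refine Algebra.adjoin_eq_span_of_subset _ (.trans ?_ Submodule.subset_span)
    intro x hx
    refine Submonoid.closure_induction (fun _ => id) ⟨1, map_one e⟩ ?_ hx
    rintro _ _ _ _ ⟨a, rfl⟩ ⟨b, rfl⟩
    exact ⟨a * b, map_mul e a b⟩
  have hsep : A.SeparatesPoints := by
    intro η η' hne
    obtain ⟨γ, hγ⟩ : ∃ γ, η.1 γ ≠ η'.1 γ := by
      by_contra! h
      exact hne (Subtype.ext (funext h))
    refine ⟨_, ⟨e γ, Algebra.subset_adjoin ⟨γ, rfl⟩, rfl⟩, fun h => hγ (Circle.ext h)⟩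
  have hdense := ContinuousMap.starSubalgebra_topologicalClosure_eq_top_of_separatesPoints A hsep
  let ι : C(K, X) := ⟨fun k => ⟨fun γ => γ k, fun a b => rfl⟩, by fun_prop⟩
  let ι' : C(K, X) := ⟨fun k => ⟨fun γ => θ γ * γ k, fun a b => by
    beta_reduce; rw [map_mul]; exact mul_mul_mul_comm _ _ _ _⟩, by fun_prop⟩
  let μ : Measure K := Measure.haar
  have hcont : ∀ j : C(K, X), Continuous fun f : C(X, ℂ) => ∫ k, f (j k) ∂μ := fun j => by
    have : ∀ f : C(X, ℂ), ∫ k, f (j k) ∂μ = inner ℂ (ContinuousMap.toLp 2 μ ℂ (1 : C(K, ℂ)))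
        (ContinuousMap.toLp 2 μ ℂ (f.comp j)) := fun f => by
      rw [ContinuousMap.inner_toLp]; simp
    simp only [this]
    exact continuous_const.inner ((ContinuousMap.toLp 2 μ ℂ).continuous.comp
      (ContinuousMap.continuous_precomp j))
  have hinteg : ∀ (j : C(K, X)) (f : C(X, ℂ)), Integrable (fun k => f (j k)) μ := fun j f =>
    (f.comp j).continuous.integrable_of_hasCompactSupport (.of_compactSpace _)
  have heq : ∀ f : C(X, ℂ), ∫ k, f (ι k) ∂μ = ∫ k, f (ι' k) ∂μ := by
    intro f
    have hf : f ∈ A.topologicalClosure := hdense ▸ StarSubalgebra.mem_top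
    refine closure_minimal (s := (A : Set C(X, ℂ))) (t := {f | ∫ k, f (ι k) ∂μ = ∫ k, f (ι' k) ∂μ})
      ?_ (isClosed_eq (hcont ι) (hcont ι')) hf
    intro f hf
    replace hf : f ∈ A.toSubalgebra.toSubmodule := hf
    rw [hA] at hf
    induction hf using Submodule.span_induction with
    | mem f hf =>
      obtain ⟨γ, rfl⟩ := hf
      have h1 : ∫ k, e γ (ι' k) ∂μ = (θ γ : ℂ) * ∫ k, (γ k : ℂ) ∂μ := by
        rw [← integral_const_mul]; rfl
      have h2 : ∫ k, e γ (ι k) ∂μ = ∫ k, (γ k : ℂ) ∂μ := rfl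
      rw [Set.mem_ofPred_eq, h1, h2]
      by_cases hγ : γ = 1
      · simp [hγ]
      · rw [integral_character_eq_zero μ hγ, mul_zero]
    | zero => simp
    | add f g _ _ hf hg =>
      simp only [Set.mem_ofPred_eq, ContinuousMap.add_apply] at hf hg ⊢
      rw [integral_add (hinteg _ _) (hinteg _ _), integral_add (hinteg _ _) (hinteg _ _), hf, hg]
    | smul c f _ hf =>
      simp only [Set.mem_ofPred_eq, ContinuousMap.smul_apply, integral_smul] at hf ⊢
      rw [hf]
  by_contra! hcon
  have hdisj : Disjoint (Set.range ι) (Set.range ι') := by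
    rw [Set.disjoint_left]
    rintro _ ⟨k, rfl⟩ ⟨k', hk⟩
    obtain ⟨χ, hχ⟩ := hcon (k * k'⁻¹)
    have : θ χ * χ k' = χ k := congrFun (congrArg Subtype.val hk) χ
    rw [map_mul, map_inv, ← this, mul_inv_cancel_right] at hχ
    exact hχ rfl
  obtain ⟨f, hf0, hf1, -⟩ := exists_continuous_zero_one_of_isClosed
    (isCompact_range ι.continuous).isClosed (isCompact_range ι'.continuous).isClosed hdisj
  have := heq ⟨fun η => (f η : ℂ), by fun_prop⟩
  have h0 : ∀ k, f (ι k) = 0 := fun k => hf0 ⟨k, rfl⟩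
  have h1 : ∀ k, f (ι' k) = 1 := fun k => hf1 ⟨k, rfl⟩
  simp only [ContinuousMap.coe_mk, h0, h1, Complex.ofReal_zero, Complex.ofReal_one, integral_zero,
    integral_const, mul_one, Complex.real_smul] at this
  exact measureReal_univ_pos.ne (by exact_mod_cast this)

/-- If characters separate the points of the compact group `K`, a rational valued functional on the
character group is induced by a homomorphism from the solenoid. -/
theorem exists_solenoid_hom [CompactSpace K] [T2Space K]
    (hsep : ∀ k : K, k ≠ 1 → ∃ χ : K →ₜ* Circle, χ k ≠ 1)
    (φ : Additive (K →ₜ* Circle) →+ ℚ) :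
    ∃ s : (ℚ → ℂ) → K, ContinuousOn s solenoid ∧
      (∀ u ∈ solenoid, ∀ v ∈ solenoid, s (u * v) = s u * s v) ∧
      ∀ u ∈ solenoid, ∀ χ : K →ₜ* Circle, (χ (s u) : ℂ) = u (φ (.ofMul χ)) := by
  classical
  have hex : ∀ u : solenoid, ∃ k : K, ∀ χ : K →ₜ* Circle, (χ k : ℂ) = u.1 (φ (.ofMul χ)) := by
    rintro ⟨u, hu⟩
    let c : ℚ → Circle := fun q => ⟨u q, by
      have := solenoid.norm_eq hu q
      simpa [Submonoid.unitSphere] using this⟩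
    have hc : ∀ q, (c q : ℂ) = u q := fun _ => rfl
    obtain ⟨k, hk⟩ := exists_eq_eval (K := K)
      { toFun := fun χ => c (φ (.ofMul χ))
        map_one' := by
          ext; rw [ofMul_one, map_zero, hc, hu.2]; simp
        map_mul' := fun a b => by
          ext
          rw [Circle.coe_mul, hc, hc, hc, hu.1.2, hu.2, one_mul, ofMul_mul, map_add] }
    exact ⟨k, fun χ => by rw [hk χ]; rfl⟩
  choose s hs using hex
  have hinj : Function.Injective fun (k : K) (χ : K →ₜ* Circle) => χ k := by
    intro k l h
    by_contra hne
    obtain ⟨χ, hχ⟩ := hsep (k * l⁻¹) (by rwa [Ne, mul_inv_eq_one])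
    have : χ k = χ l := congrFun h χ
    rw [map_mul, map_inv, this, mul_inv_cancel] at hχ
    exact hχ rfl
  have hemb : Topology.IsClosedEmbedding fun (k : K) (χ : K →ₜ* Circle) => χ k :=
    Continuous.isClosedEmbedding (by fun_prop) hinj
  have hscont : Continuous s := by
    rw [hemb.isInducing.continuous_iff, continuous_pi_iff]
    intro χ
    rw [isInducing_circle_coe.continuous_iff]
    refine ((continuous_apply (φ (.ofMul χ))).comp continuous_subtype_val).congr fun u => ?_
    exact (hs u χ).symm
  refine ⟨fun u => if h : u ∈ solenoid then s ⟨u, h⟩ else 1, ?_, fun u hu v hv => ?_,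
    fun u hu χ => ?_⟩
  · rw [continuousOn_iff_continuous_domRestrict]
    refine hscont.congr fun u => ?_
    simp [Set.domRestrict]
  · beta_reduce
    rw [dif_pos hu, dif_pos hv, dif_pos (solenoid.mul_mem hu hv)]
    refine hinj (funext fun χ => Circle.ext ?_)
    simp [hs]
  · beta_reduce
    rw [dif_pos hu]
    exact hs _ χ

end Duality

theorem exists_addMonoidHom_rat {Γ : Type*} [AddCommGroup Γ] {x : Γ}
    (hx : ∀ m : ℤ, m ≠ 0 → m • x ≠ 0) :
    ∃ φ : Γ →+ ℚ, φ x = 1 := by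
  have hinj : Function.Injective (zmultiplesHom Γ x) := by
    rw [injective_iff_map_eq_zero]
    intro m hm
    by_contra h
    exact hx m h hm
  obtain ⟨φ, hφ⟩ := (Module.Baer.of_divisible ℚ).extension_property_addMonoidHom _ hinj
    (Int.castAddHom ℚ)
  refine ⟨φ, ?_⟩
  simpa using DFunLike.congr_fun hφ 1

theorem IsAE.preconnectedSpace {G : Type u} [TopologicalSpace G] {n : ℕ} (h : IsAE n G)
    (hn : 2 ≤ n) : PreconnectedSpace G := by
  classical
  refine ⟨isPreconnected_of_forall_pair fun x _ y _ => ?_⟩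
  obtain ⟨F, hF, hFf⟩ := h.exists_extension (d := 1) hn (A := ℝ) (K := Set.Icc 0 1) (K₀ := {0, 1})
    isCompact_Icc (Set.toFinite _).isClosed (by rintro t (rfl | rfl) <;> simp)
    (fun _ t _ => (t : ℂ)) (fun _ => by fun_prop) (fun _ _ _ _ _ _ _ e => e)
    (fun t _ t' _ e => by simpa using congrFun (e 0) 0)
    (fun t => if t = 0 then x else y)
    (Set.Finite.continuousOn (Set.toFinite _) _)
  refine ⟨F '' Set.Icc 0 1, Set.subset_univ _, ⟨0, by simp, ?_⟩, ⟨1, by simp, ?_⟩,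
    isPreconnected_Icc.image _ hF⟩
  · simpa using hFf (x := 0) (by simp)
  · simpa using hFf (x := 1) (by simp)

theorem sum_norm_sq_of_mem_unitaryGroup {n : ℕ} {M : Matrix (Fin n) (Fin n) ℂ}
    (hM : M ∈ Matrix.unitaryGroup (Fin n) ℂ) (ξ : Fin n → ℂ) :
    ∑ j, ‖∑ i, M i j * ξ i‖ ^ 2 = ∑ i, ‖ξ i‖ ^ 2 := by
  have key : ∀ v : Fin n → ℂ, ((∑ j, ‖v j‖ ^ 2 : ℝ) : ℂ) = dotProduct v (star v) := fun v => by
    simp [dotProduct, Complex.mul_conj, Complex.normSq_eq_norm_sq]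
  have h : ((∑ j, ‖∑ i, M i j * ξ i‖ ^ 2 : ℝ) : ℂ) = ((∑ i, ‖ξ i‖ ^ 2 : ℝ) : ℂ) := by
    have hv : (fun j => ∑ i, M i j * ξ i) = Matrix.vecMul ξ M := by
      ext j; simp [Matrix.vecMul, dotProduct, mul_comm]
    rw [key, key, hv, Matrix.star_vecMul, Matrix.dotProduct_mulVec, Matrix.vecMul_vecMul,
      ← Matrix.star_eq_conjTranspose, Matrix.mem_unitaryGroup_iff.1 hM, Matrix.vecMul_one]
  exact_mod_cast h

theorem eq_diagonal_of_diagonalization {n : ℕ} {P : Matrix (Fin n) (Fin n) ℂ}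
    (hP : P ∈ Matrix.unitaryGroup (Fin n) ℂ) {d d' : Fin n → ℂ}
    (h : Matrix.diagonal d * P = Matrix.diagonal d' * P) : d = d' := by
  refine Matrix.diagonal_injective ?_
  have := congrArg (· * star P) h
  simpa only [Matrix.mul_assoc, Matrix.mem_unitaryGroup_iff.1 hP, Matrix.mul_one] using this

/-- Characters separate the points of a monothetic subgroup of a compact group. -/
theorem exists_character_ne_one {G : Type u} [Group G] [TopologicalSpace G] [IsTopologicalGroup G]
    [CompactSpace G] [T2Space G] {g : G} {k : (Subgroup.zpowers g).topologicalClosure}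
    (hk : k ≠ 1) : ∃ χ : (Subgroup.zpowers g).topologicalClosure →ₜ* Circle, χ k ≠ 1 := by
  obtain ⟨n, ρ, hρ, hU, hne⟩ := exists_unitary_rep_ne_one (g := (k : G)) (by simpa using hk)
  obtain ⟨P, hP, d, hd⟩ := exists_unitary_diagonalization (hU g)
  obtain ⟨χ, hχ⟩ := exists_characters hρ hU hP hd
  by_contra! hcon
  refine hne ?_
  have : P * ρ k = P := by simpa [hcon] using hχ k
  rw [← Matrix.one_mul (ρ k), ← Matrix.mem_unitaryGroup_iff'.1 hP, Matrix.mul_assoc, this]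

theorem IsAE.eq_one {G : Type u} [Group G] [TopologicalSpace G] [IsTopologicalGroup G]
    [CompactSpace G] [T2Space G] (h : IsAE 4 G) (x : G) : x = 1 := by
  by_contra hx
  have := h.preconnectedSpace (by norm_num)
  obtain ⟨n, ρ, hρ, hU, hne⟩ := exists_unitary_rep_ne_one hx
  obtain ⟨g, P, hP, d, hd, i₀, hi₀⟩ := exists_eigenvalue_infinite_order hρ hU hne
  obtain ⟨χ, hχ⟩ := exists_characters hρ hU hP hd
  let K := (Subgroup.zpowers g).topologicalClosure
  have : CompactSpace K :=
    isCompact_iff_compactSpace.1 (Subgroup.isClosed_topologicalClosure _).isCompact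
  let γ : K := ⟨g, Subgroup.le_topologicalClosure _ (Subgroup.mem_zpowers g)⟩
  have hγ : ∀ i, (χ i γ : ℂ) = d i :=
    congrFun (eq_diagonal_of_diagonalization hP ((hχ γ).symm.trans hd))
  obtain ⟨φ, hφ⟩ := exists_addMonoidHom_rat (x := Additive.ofMul (χ i₀)) fun m hm e => by
    have h1 : χ i₀ ^ m = 1 := e
    have h2 : d i₀ ^ m = 1 := by
      let ev : (K →ₜ* Circle) →* Circle := ⟨⟨fun η => η γ, rfl⟩, fun _ _ => rfl⟩
      have h3 : χ i₀ γ ^ m = 1 := (map_zpow ev (χ i₀) m).symm.trans (by rw [h1, map_one])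
      rw [← hγ, ← Circle.coe_zpow, h3, Circle.coe_one]
    rcases Int.natAbs_eq m with hm' | hm'
    · rw [hm', zpow_natCast] at h2
      exact hi₀ _ (Int.natAbs_pos.2 hm) h2
    · rw [hm', zpow_neg, zpow_natCast, inv_eq_one] at h2
      exact hi₀ _ (Int.natAbs_pos.2 hm) h2
  obtain ⟨s, hs, hmul, hsχ⟩ := exists_solenoid_hom (fun k hk => exists_character_ne_one hk) φ
  obtain ⟨F, hF, hFeq⟩ := h.exists_equivariant (s := fun u => (s u : G))
    (continuous_subtype_val.comp_continuousOn hs)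
    (fun u hu v hv => congrArg Subtype.val (hmul u hu v hv)) 3 (by norm_num)
  rw [continuousOn_iff_continuous_domRestrict] at hF
  let f : Fin n → Fin n → C(solSphere 3, ℂ) := fun i j =>
    ⟨fun w => (P * ρ (F w)) i j,
      (continuous_const.matrix_mul (hρ.comp hF)).matrix_elem i j⟩
  have := weights_eq_zero (f := f) (a := fun i => φ (.ofMul (χ i)))
    (fun w ξ => sum_norm_sq_of_mem_unitaryGroup (mul_mem hP (hU (F w))) ξ) ?_ i₀
  · rw [hφ] at this
    exact one_ne_zero this
  · intro u hu w w' hw i j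
    change (P * ρ (F w'.1)) i j = u (φ (.ofMul (χ i))) * (P * ρ (F w.1)) i j
    rw [hw, hFeq u hu _ w.2, map_mul, ← Matrix.mul_assoc, hχ (s u), Matrix.mul_assoc,
      Matrix.diagonal_mul, hsχ u hu]

/-- There is no nontrivial compact AE(4)-group: every compact Hausdorff topological
group whose underlying space is an AE(4)-compactum consists of a single element. -/
theorem compact_AE4_group_subsingleton (G : Type u) [Group G] [TopologicalSpace G]
    [IsTopologicalGroup G] [CompactSpace G] [T2Space G] (h : IsAE 4 G) :
    ∃ g : G, ∀ x : G, x = g := by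
  exact ⟨1, h.eq_one⟩
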